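/- (Lemma B.3) All periodic Temperley–Lieb intertwiners between sectors whose S^z-values differ by an even integer come from U_q^odd sl(2) together with the top fermion products: for integers k, t with 0 ≤ k ≤ N and 0 ≤ k−2t ≤ N, every linear map T : H_(k) → H_(k−2t) satisfying T e_j = e_j T on H_(k) for all 1 ≤ j ≤ N (periodic convention) is the restriction to H_(k) of an element of the unital subalgebra of End(H) generated by {F_(2n+1), F†_(2n+1) : 0 ≤ n ≤ L−1} ∪ {F_(N), F†_(N)} ∪ {S^z}. -/

import Mathlib

open Complex Matrix

noncomputable section

namespace SpinChain

/-- The state space of the `N`-site spin chain, `(ℂ²)^{⊗N}` realised as functions on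
spin configurations. -/
abbrev V (N : ℕ) := (Fin N → Fin 2) → ℂ

/-- Operators on the spin chain, realised as matrices. -/
abbrev Op (N : ℕ) := Matrix (Fin N → Fin 2) (Fin N → Fin 2) ℂ

def sigmaX : Matrix (Fin 2) (Fin 2) ℂ := !![0, 1; 1, 0]
def sigmaY : Matrix (Fin 2) (Fin 2) ℂ := !![0, -I; I, 0]
def sigmaZ : Matrix (Fin 2) (Fin 2) ℂ := !![1, 0; 0, -1]
def sigmaPlus : Matrix (Fin 2) (Fin 2) ℂ := ((1 : ℂ)/2) • (sigmaX + I • sigmaY)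
def sigmaMinus : Matrix (Fin 2) (Fin 2) ℂ := ((1 : ℂ)/2) • (sigmaX - I • sigmaY)

variable (N : ℕ)

/-- The operator acting as the 2×2 matrix `a` on the `j`-th tensor factor and as the
identity on the others. -/
def site (a : Matrix (Fin 2) (Fin 2) ℂ) (j : Fin N) : Op N :=
  Matrix.of fun x y =>
    a (x j) (y j) * ∏ k ∈ Finset.univ.filter (fun k => k ≠ j), (if x k = y k then (1 : ℂ) else 0)

/-- Jordan–Wigner string `∏_{k<j} diag(z 0, z 1)_k`. -/
def string (z : Fin 2 → ℂ) (j : Fin N) : Op N :=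
  (((List.finRange N).filter (fun k => decide (k < j))).map
    (fun k => site N (Matrix.diagonal z) k)).prod

/-- Jordan–Wigner fermion `c_j := i^{1−j}·(∏_{k<j} diag(−i,i)_k)·σ⁻_j`; here the index
`j : Fin N` labels the physical site `j+1`. -/
def c (j : Fin N) : Op N :=
  (I ^ (-(j : ℤ))) • (string N ![-I, I] j * site N sigmaMinus j)

/-- Jordan–Wigner fermion `c_j† := i^{j−1}·(∏_{k<j} diag(i,−i)_k)·σ⁺_j`. -/
def cd (j : Fin N) : Op N :=
  (I ^ ((j : ℕ))) • (string N ![I, -I] j * site N sigmaPlus j)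

/-- The `gl(1|1)` fermion `f_j := i^j c_j` (physical index `j = j.val + 1`). -/
def f (j : Fin N) : Op N := (I ^ ((j : ℕ) + 1)) • c N j

/-- The `gl(1|1)` fermion `f_j† := i^j c_j†`. -/
def fd (j : Fin N) : Op N := (I ^ ((j : ℕ) + 1)) • cd N j

/-- Cyclic successor on site indices. -/
def fsucc {N : ℕ} (j : Fin N) : Fin N := ⟨(j.val + 1) % N, Nat.mod_lt _ j.pos⟩

/-- Periodic Temperley–Lieb generators
`e_j = (f_j+f_{j+1})(f_j†+f_{j+1}†)`, with `e_N = (f_N+f_1)(f_N†+f_1†)`. -/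
def e (j : Fin N) : Op N := (f N j + f N (fsucc j)) * (fd N j + fd N (fsucc j))

/-- `F_(m) := Σ_{j_1<⋯<j_m} f_{j_1}⋯f_{j_m}`. -/
def Fg (m : ℕ) : Op N :=
  ∑ s ∈ Finset.univ.powersetCard m, ((s.sort (· ≤ ·)).map (f N)).prod

/-- `F†_(m) := Σ_{j_1<⋯<j_m} f†_{j_1}⋯f†_{j_m}`. -/
def Fdg (m : ℕ) : Op N :=
  ∑ s ∈ Finset.univ.powersetCard m, ((s.sort (· ≤ ·)).map (fd N)).prod

/-- `S^z := (1/2) Σ_j σ^z_j`. -/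
def Sz : Op N := ((1 : ℂ)/2) • ∑ j : Fin N, site N sigmaZ j


/-- The sector `H_(k)`: the eigenspace of `S^z` with eigenvalue `L − k`. -/
def sector (L : ℕ) (k : ℤ) : Submodule ℂ (V (2 * L)) :=
  Module.End.eigenspace (Matrix.mulVecLin (Sz (2 * L))) ((L : ℂ) - (k : ℂ))

/-- The space of periodic Temperley–Lieb intertwiners `H_(k) → H_(k−2t)`. -/
def EperEvenSet (L : ℕ) (k t : ℤ) :
    Set (↥(sector L k) →ₗ[ℂ] ↥(sector L (k - 2 * t))) :=
  {T | ∀ j : Fin (2 * L),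
    ∀ v w : ↥(sector L k), (w : V (2 * L)) = (e (2 * L) j).mulVec (v : V (2 * L)) →
      ((T w : V (2 * L))) = (e (2 * L) j).mulVec ((T v : V (2 * L)))}

/-- The generating set: the odd symmetry generators `F_(2n+1)`, `F†_(2n+1)`
(`0 ≤ n ≤ L−1`), the top products `F_(N)`, `F†_(N)`, and `S^z`. -/
def centGens (L : ℕ) : Set (Op (2 * L)) :=
  {T | (∃ n : ℕ, n < L ∧ T = Fg (2 * L) (2 * n + 1)) ∨
       (∃ n : ℕ, n < L ∧ T = Fdg (2 * L) (2 * n + 1)) ∨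
       T = Fg (2 * L) (2 * L) ∨ T = Fdg (2 * L) (2 * L) ∨ T = Sz (2 * L)}

/-- Canonical anticommutation relations for creation operators `c` and annihilation
operators `d`. -/
structure CAR {ι W : Type*} [DecidableEq ι] [AddCommGroup W] [Module ℂ W]
    (c d : ι → Module.End ℂ W) : Prop where
  cc : ∀ p q v, c p (c q v) = -c q (c p v)
  dd : ∀ p q v, d p (d q v) = -d q (d p v)
  dc : ∀ p q v, d p (c q v) = (if p = q then v else 0) - c q (d p v)

section Occupation

variable {ι W : Type*} [AddCommGroup W] [Module ℂ W] {c d : ι → Module.End ℂ W}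

lemma eq_zero_of_eq_neg {v : W} (h : v = -v) : v = 0 := by
  have h2 : (2 : ℂ) • v = 0 := by
    rw [two_smul]
    nth_rewrite 1 [h]
    exact neg_add_cancel v
  simpa using h2

/-- Vectors with occupation numbers `s`. -/
def occ (c d : ι → Module.End ℂ W) (s : ι → Bool) : Submodule ℂ W :=
  ⨅ p, LinearMap.ker (if s p then c p else d p)

lemma mem_occ {s : ι → Bool} {v : W} :
    v ∈ occ c d s ↔ ∀ p, (s p = true → c p v = 0) ∧ (s p = false → d p v = 0) := by
  simp only [occ, Submodule.mem_iInf, LinearMap.mem_ker]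
  refine forall_congr' fun p => ?_
  cases s p <;> simp

end Occupation

section Fock

variable {ι W : Type*} [DecidableEq ι] [AddCommGroup W] [Module ℂ W]
  {c d : ι → Module.End ℂ W}

namespace CAR

lemma cc_self (h : CAR c d) (p : ι) (v : W) : c p (c p v) = 0 :=
  eq_zero_of_eq_neg (h.cc p p v)

lemma dd_self (h : CAR c d) (p : ι) (v : W) : d p (d p v) = 0 :=
  eq_zero_of_eq_neg (h.dd p p v)

lemma c_mem_occ (h : CAR c d) {s : ι → Bool} {v : W} (hv : v ∈ occ c d s) (p : ι) :
    c p v ∈ occ c d (Function.update s p true) := by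
  rw [mem_occ] at hv ⊢
  intro q
  obtain rfl | hq := eq_or_ne q p
  · simp [h.cc_self]
  · simp only [Function.update_of_ne hq]
    exact ⟨fun hs => by rw [h.cc, (hv q).1 hs, map_zero, neg_zero],
      fun hs => by simp [h.dc, hq, (hv q).2 hs]⟩

lemma d_mem_occ (h : CAR c d) {s : ι → Bool} {v : W} (hv : v ∈ occ c d s) (p : ι) :
    d p v ∈ occ c d (Function.update s p false) := by
  rw [mem_occ] at hv ⊢
  intro q
  obtain rfl | hq := eq_or_ne q p
  · simp [h.dd_self]
  · simp only [Function.update_of_ne hq]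
    refine ⟨fun hs => ?_, fun hs => by rw [h.dd, (hv q).2 hs, map_zero, neg_zero]⟩
    have := h.dc p q v
    rw [(hv q).1 hs, map_zero, if_neg hq.symm, zero_sub, eq_comm, neg_eq_zero] at this
    exact this

lemma cd_of_c_eq_zero (h : CAR c d) {p : ι} {v : W} (hv : c p v = 0) : c p (d p v) = v := by
  have := h.dc p p v
  rw [hv, map_zero, if_pos rfl] at this
  exact (sub_eq_zero.1 this.symm).symm

lemma dc_of_d_eq_zero (h : CAR c d) {p : ι} {v : W} (hv : d p v = 0) : d p (c p v) = v := by
  simp [h.dc, hv]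

/-- A submodule stable under the number operators is spanned by its vectors with definite
occupation numbers. -/
lemma le_of_occ_le [Fintype ι] (h : CAR c d) (Q S : Submodule ℂ W)
    (hQ : ∀ p, ∀ v ∈ Q, c p (d p v) ∈ Q) (hS : ∀ s, ∀ v ∈ Q, v ∈ occ c d s → v ∈ S) :
    Q ≤ S := by
  suffices H : ∀ J : Finset ι, ∀ v ∈ Q, (∀ p ∉ J, c p v = 0 ∨ d p v = 0) → v ∈ S from
    fun v hv => H Finset.univ v hv (by simp)
  intro J
  induction J using Finset.induction_on with
  | empty =>
    intro v hv hJ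
    classical
    refine hS (fun p => decide (c p v = 0)) v hv (mem_occ.2 fun p => ?_)
    have := hJ p (by simp)
    simp only [decide_eq_true_eq, decide_eq_false_iff_not]
    tauto
  | insert a J ha ih =>
    intro v hv hJ
    have e : v = c a (d a v) + d a (c a v) := by simp [h.dc]
    have hd : d a (c a v) ∈ Q := by
      have : d a (c a v) = v - c a (d a v) := by simp [h.dc]
      rw [this]; exact Q.sub_mem hv (hQ a v hv)
    rw [e]
    refine S.add_mem (ih _ (hQ a v hv) fun p hp => ?_) (ih _ hd fun p hp => ?_)
    · obtain rfl | hpa := eq_or_ne p a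
      · exact .inl (h.cc_self _ _)
      · obtain h0 | h0 := hJ p (by simp [hp, hpa])
        · left
          have := h.dc a p v
          rw [h0, map_zero, if_neg hpa.symm, zero_sub, eq_comm, neg_eq_zero] at this
          rw [h.cc, this, map_zero, neg_zero]
        · right
          rw [h.dc, if_neg hpa, h.dd, h0]; simp
    · obtain rfl | hpa := eq_or_ne p a
      · exact .inr (h.dd_self _ _)
      · obtain h0 | h0 := hJ p (by simp [hp, hpa])
        · left
          have := h.dc a p (c a v)
          rw [if_neg hpa.symm, zero_sub, h.cc, h0] at this
          simpa using this.symm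
        · right
          rw [h.dd, h.dc, if_neg hpa, h0]; simp

end CAR

/-- The number of occupied modes. -/
def count [Fintype ι] (s : ι → Bool) : ℕ := (Finset.univ.filter (fun p => s p = true)).card

lemma count_update_false [Fintype ι] {s : ι → Bool} {p : ι} (hp : s p = true) :
    count s = count (Function.update s p false) + 1 := by
  have : Finset.univ.filter (fun q => Function.update s p false q = true)
      = (Finset.univ.filter (fun q => s q = true)).erase p := by
    ext q
    by_cases hq : q = p <;> simp [hq, Function.update_apply]
  rw [count, count, this, Finset.card_erase_add_one (by simpa using hp)]

lemma occupation_induction [Fintype ι] {P : (ι → Bool) → Prop}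
    (h0 : P fun _ => false)
    (hstep : ∀ s p, s p = true → P (Function.update s p false) → P s) (s : ι → Bool) : P s := by
  suffices H : ∀ m (s : ι → Bool), count s = m → P s from H _ s rfl
  intro m
  induction m with
  | zero =>
    intro s hs
    convert h0 with p
    rw [count, Finset.card_eq_zero, Finset.filter_eq_empty_iff] at hs
    simpa using hs (Finset.mem_univ p)
  | succ m ih =>
    intro s hs
    obtain ⟨p, hp⟩ : ∃ p, s p = true := by
      by_contra! hcon
      simp [count, hcon] at hs
    exact hstep s p hp (ih _ (by have := count_update_false hp; omega))

/-- An irreducible Fock representation with number operator `num` and vacuum `vac`. -/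
structure FockRep (c d : ι → Module.End ℂ W) (num : Module.End ℂ W) (vac : W) : Prop
    extends CAR c d where
  num_c : ∀ p v, num (c p v) = c p (num v) + c p v
  num_d : ∀ p v, num (d p v) = d p (num v) - d p v
  num_vac : num vac = 0
  vac_ne_zero : vac ≠ 0
  d_vac : ∀ p, d p vac = 0
  exists_smul_vac : ∀ v, (∀ p, d p v = 0) → ∃ t : ℂ, v = t • vac

namespace FockRep

variable [Fintype ι] {num : Module.End ℂ W} {vac : W}

lemma exists_smul (h : FockRep c d num vac) (s : ι → Bool) :
    ∀ u ∈ occ c d s, ∀ v ∈ occ c d s, u ≠ 0 → ∃ t : ℂ, v = t • u := by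
  induction s using occupation_induction with
  | h0 =>
    intro u hu v hv hu0
    obtain ⟨x, rfl⟩ := h.exists_smul_vac u fun p => (mem_occ.1 hu p).2 rfl
    obtain ⟨y, rfl⟩ := h.exists_smul_vac v fun p => (mem_occ.1 hv p).2 rfl
    have hx : x ≠ 0 := fun hx => hu0 (by simp [hx])
    exact ⟨y / x, by rw [smul_smul, div_mul_cancel₀ _ hx]⟩
  | hstep s p hp ih =>
    intro u hu v hv hu0
    have eu := h.cd_of_c_eq_zero ((mem_occ.1 hu p).1 hp)
    have ev := h.cd_of_c_eq_zero ((mem_occ.1 hv p).1 hp)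
    obtain ⟨t, ht⟩ := ih _ (h.d_mem_occ hu p) _ (h.d_mem_occ hv p)
      (fun h0 => hu0 (by rw [← eu, h0, map_zero]))
    exact ⟨t, by rw [← ev, ht, map_smul, eu]⟩

lemma num_eq (h : FockRep c d num vac) (s : ι → Bool) :
    ∀ v ∈ occ c d s, num v = (count s : ℂ) • v := by
  induction s using occupation_induction with
  | h0 =>
    intro v hv
    obtain ⟨x, rfl⟩ := h.exists_smul_vac v fun p => (mem_occ.1 hv p).2 rfl
    simp [h.num_vac, count]
  | hstep s p hp ih =>
    intro v hv
    have ev := h.cd_of_c_eq_zero ((mem_occ.1 hv p).1 hp)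
    rw [← ev, h.num_c, ih _ (h.d_mem_occ hv p), count_update_false hp, map_smul]
    push_cast
    rw [add_smul, one_smul]

lemma exists_ne_zero (h : FockRep c d num vac) (s : ι → Bool) : ∃ v ∈ occ c d s, v ≠ 0 := by
  induction s using occupation_induction with
  | h0 => exact ⟨vac, mem_occ.2 fun p => ⟨by simp, fun _ => h.d_vac p⟩, h.vac_ne_zero⟩
  | hstep s p hp ih =>
    obtain ⟨v, hv, hv0⟩ := ih
    refine ⟨c p v, ?_, fun h0 => hv0 ?_⟩
    · have := h.c_mem_occ hv p
      rwa [Function.update_idem, Function.update_eq_self_iff.2 hp.symm] at this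
    · rw [← h.dc_of_d_eq_zero ((mem_occ.1 hv p).2 (by simp)), h0, map_zero]

lemma count_eq (h : FockRep c d num vac) {s : ι → Bool} {v : W} (hv : v ∈ occ c d s)
    (hv0 : v ≠ 0) {k : ℕ} (hk : num v = (k : ℂ) • v) : count s = k := by
  rw [h.num_eq s v hv] at hk
  exact_mod_cast smul_left_injective ℂ hv0 hk

end FockRep

/-- The projection onto the vectors with occupation numbers `s`. -/
lemma CAR.exists_proj [Fintype ι] (h : CAR c d) (s : ι → Bool) :
    ∃ π : Module.End ℂ W, (∀ v ∈ occ c d s, π v = v) ∧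
      ∀ s', s' ≠ s → ∀ v ∈ occ c d s', π v = 0 := by
  suffices H : ∀ l : List ι, ∃ π : Module.End ℂ W, ∀ s', ∀ v ∈ occ c d s',
      π v = if ∀ p ∈ l, s' p = s p then v else 0 by
    obtain ⟨π, hπ⟩ := H Finset.univ.toList
    refine ⟨π, fun v hv => by simp [hπ s v hv], fun s' hs v hv => ?_⟩
    rw [hπ s' v hv, if_neg]
    exact fun hcon => hs (funext fun p => hcon p (by simp))
  intro l
  induction l with
  | nil => exact ⟨1, by simp⟩
  | cons p l ih =>
    obtain ⟨π, hπ⟩ := ih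
    refine ⟨(if s p then c p * d p else d p * c p) * π, fun s' v hv => ?_⟩
    rw [Module.End.mul_apply, hπ s' v hv]
    have hvp := mem_occ.1 hv p
    by_cases hl : ∀ q ∈ l, s' q = s q
    · have hiff : (∀ q ∈ p :: l, s' q = s q) ↔ s' p = s p := by
        rw [List.forall_mem_cons]
        exact and_iff_left hl
      simp only [if_pos hl, hiff]
      cases hs : s p <;> cases hs' : s' p
      · simp [h.dc, hvp.2 hs']
      · simp [hvp.1 hs']
      · simp [hvp.2 hs']
      · simp [h.cd_of_c_eq_zero (hvp.1 hs')]
    · rw [if_neg hl, map_zero, if_neg]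
      simp only [List.mem_cons, forall_eq_or_imp]
      tauto

end Fock

section Pairs

variable {P W : Type*} [DecidableEq P] [AddCommGroup W] [Module ℂ W]

/-- Modes: a pair `am i`, `bm i` for every `i`, and the special pair `Fm`, `wm`. -/
abbrev Mode (P : Type*) := Option P × Bool

abbrev am (i : P) : Mode P := (some i, false)
abbrev bm (i : P) : Mode P := (some i, true)
abbrev Fm : Mode P := (none, false)
abbrev wm : Mode P := (none, true)

/-- Generators of the Lie algebra of bilinears spanned by the periodic Temperley–Lieb
generators. -/
inductive SymOp (c d : Mode P → Module.End ℂ W) : Module.End ℂ W → Prop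
  | ab (i : P) : SymOp c d (c (am i) * d (bm i))
  | ba (i : P) : SymOp c d (c (bm i) * d (am i))
  | raise (i j : P) (h : i ≠ j) : SymOp c d (c (am i) * d (bm j) + c (am j) * d (bm i))
  | lower (i j : P) (h : i ≠ j) : SymOp c d (c (bm i) * d (am j) + c (bm j) * d (am i))
  | move (i j : P) (h : i ≠ j) : SymOp c d (c (am i) * d (am j) - c (bm j) * d (bm i))
  | toPair (i : P) (β : Bool) : SymOp c d (c (some i, β) * d wm)
  | fromPair (i : P) (β : Bool) : SymOp c d (c Fm * d (some i, β))
  | special : SymOp c d (c Fm * d wm)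

/-- The pairs occupied by exactly one fermion. -/
def sing [Fintype P] (s : Mode P → Bool) : Finset P :=
  Finset.univ.filter fun i => s (am i) ≠ s (bm i)

variable [Fintype P]

lemma count_pairs {P : Type*} [Fintype P] (s : Mode P → Bool) :
    count s = (s Fm).toNat + (s wm).toNat + ∑ i, ((s (am i)).toNat + (s (bm i)).toNat) := by
  have h1 : ∀ x : Bool, (if x = true then 1 else 0) = x.toNat := by decide
  rw [count, Finset.card_filter, Fintype.sum_prod_type]
  simp only [Fintype.sum_option, Fintype.sum_bool, h1]
  rw [add_comm (s (none, true)).toNat]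
  congr 1
  exact Finset.sum_congr rfl fun i _ => add_comm _ _

lemma count_parity {P : Type*} [Fintype P] (s : Mode P → Bool) :
    count s % 2 = ((s Fm).toNat + (s wm).toNat + (sing s).card) % 2 := by
  have : (∑ i, ((s (am i)).toNat + (s (bm i)).toNat)) % 2 = (sing s).card % 2 := by
    rw [sing, Finset.card_filter, Finset.sum_nat_mod]
    congr 1
    refine Finset.sum_congr rfl fun i _ => ?_
    cases s (am i) <;> cases s (bm i) <;> simp
  rw [count_pairs]
  omega

variable {c d : Mode P → Module.End ℂ W} {num : Module.End ℂ W} {vac : W}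

lemma FockRep.num_cd {ι : Type*} [DecidableEq ι] {c d : ι → Module.End ℂ W}
    (h : FockRep c d num vac) {k : ℂ} {v : W} (hv : num v = k • v)
    (p q : ι) : num (c p (d q v)) = k • c p (d q v) := by
  rw [h.num_c, h.num_d, hv]
  simp

/-- A singly occupied pair may be assumed to be of type `am`. -/
lemma FockRep.exists_flip (h : FockRep c d num vac) (S : Submodule ℂ W)
    (hS : ∀ X, SymOp c d X → ∀ v ∈ S, X v ∈ S) {k : ℂ} {s : Mode P → Bool} {v : W} {i : P}
    (hi : i ∈ sing s) (hv : v ∈ occ c d s) (hk : num v = k • v) :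
    ∃ s' v', s' (am i) = true ∧ s' (bm i) = false ∧ (∀ p, p.1 ≠ some i → s' p = s p) ∧
      sing s' = sing s ∧ v' ∈ occ c d s' ∧ num v' = k • v' ∧ (v' ∈ S → v ∈ S) := by
  have hi' : s (am i) ≠ s (bm i) := by simpa [sing] using hi
  cases ha : s (am i)
  · have hb : s (bm i) = true := by simpa [ha] using hi'.symm
    have hp : ∀ p : Mode P, p.1 ≠ some i →
        Function.update (Function.update s (bm i) false) (am i) true p = s p := by
      rintro ⟨p, β⟩ hp
      simp only [Function.update_apply, Prod.mk.injEq]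
      simp_all
    refine ⟨_, c (am i) (d (bm i) v), by simp, by simp, hp, ?_,
      h.c_mem_occ (h.d_mem_occ hv (bm i)) (am i), h.num_cd hk _ _, fun hvS => ?_⟩
    · ext x
      obtain rfl | hx := eq_or_ne x i
      · simpa [sing] using hi'
      · simp only [sing, Finset.mem_filter, hp (am x) (by simpa using hx),
          hp (bm x) (by simpa using hx)]
    · have e : (c (bm i) * d (am i)) (c (am i) (d (bm i) v)) = v := by
        rw [Module.End.mul_apply, h.dc, if_pos rfl, h.dd, (mem_occ.1 hv _).2 ha]
        simp [h.cd_of_c_eq_zero ((mem_occ.1 hv _).1 hb)]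
      rw [← e]
      exact hS _ (.ba i) _ hvS
  · exact ⟨s, v, ha, by simpa [ha] using hi'.symm, fun _ _ => rfl, rfl, hv, hk, id⟩

/-- Vectors with `wm` occupied and `Fm` empty are generated by those with at most one singly
occupied pair. -/
lemma FockRep.mem_of_wm (h : FockRep c d num vac) (S : Submodule ℂ W)
    (hS : ∀ X, SymOp c d X → ∀ v ∈ S, X v ∈ S) (k : ℂ)
    (hbase : ∀ s v, s wm = true → s Fm = false → (sing s).card ≤ 1 → v ∈ occ c d s →
      num v = k • v → v ∈ S) :
    ∀ s v, s wm = true → s Fm = false → v ∈ occ c d s → num v = k • v → v ∈ S := by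
  suffices H : ∀ m s v, (sing s).card = m → s wm = true → s Fm = false → v ∈ occ c d s →
      num v = k • v → v ∈ S from fun s v => H _ s v rfl
  intro m
  induction m using Nat.strong_induction_on with
  | _ m ih =>
  intro s v hm hw hF hv hk
  obtain hle | hlt := le_or_gt (sing s).card 1
  · exact hbase s v hw hF hle hv hk
  obtain ⟨i, hi, j, hj, hij⟩ := Finset.one_lt_card.1 hlt
  obtain ⟨s₁, v₁, ha₁, hb₁, hp₁, hsing₁, hv₁, hk₁, hS₁⟩ := h.exists_flip S hS hi hv hk
  obtain ⟨s₂, v₂, ha₂, hb₂, hp₂, hsing₂, hv₂, hk₂, hS₂⟩ :=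
    h.exists_flip S hS (hsing₁ ▸ hj) hv₁ hk₁
  refine hS₁ (hS₂ ?_)
  have hai : s₂ (am i) = true := by rw [hp₂ _ (by simpa using hij), ha₁]
  have hbi : s₂ (bm i) = false := by rw [hp₂ _ (by simpa using hij), hb₁]
  have hw₂ : s₂ wm = true := by rw [hp₂ _ (by simp), hp₁ _ (by simp), hw]
  have hF₂ : s₂ Fm = false := by rw [hp₂ _ (by simp), hp₁ _ (by simp), hF]
  have lower : ∀ x y, x ≠ y → x ∈ sing s₂ → s₂ (am x) = true → s₂ (bm x) = false →
      s₂ (am y) = true → s₂ (bm y) = false → c (bm x) (d (am y) v₂) ∈ S := by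
    intro x y hxy hx hax hbx hay hby
    refine ih _ ?_ _ _ rfl ?_ ?_ (h.c_mem_occ (h.d_mem_occ hv₂ (am y)) (bm x)) (h.num_cd hk₂ _ _)
    · rw [← hm, ← hsing₁, ← hsing₂]
      refine Finset.card_lt_card ((Finset.ssubset_iff_of_subset fun z hz => ?_).2 ⟨x, hx, ?_⟩)
      · by_cases hzx : z = x
        · rwa [hzx]
        · by_cases hzy : z = y
          · simp [sing, Function.update_apply, hzy, hby, hxy.symm] at hz
          · simpa [sing, Function.update_apply, hzx, hzy] using hz
      · simp [sing, Function.update_apply, hax, hxy]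
    · simp [hw₂]
    · simp [hF₂]
  have hlow : (c (bm i) * d (am j) + c (bm j) * d (am i)) v₂ ∈ S := by
    rw [LinearMap.add_apply]
    exact S.add_mem (lower i j hij (by rw [hsing₂, hsing₁]; exact hi) hai hbi ha₂ hb₂)
      (lower j i hij.symm (by rw [hsing₂, hsing₁]; exact hj) ha₂ hb₂ hai hbi)
  have e : (c (am i) * d (bm j) + c (am j) * d (bm i))
      ((c (bm i) * d (am j) + c (bm j) * d (am i)) v₂) = (2 : ℂ) • v₂ := by
    have ei := h.cd_of_c_eq_zero ((mem_occ.1 hv₂ _).1 hai)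
    have ej := h.cd_of_c_eq_zero ((mem_occ.1 hv₂ _).1 ha₂)
    have di := (mem_occ.1 hv₂ _).2 hbi
    have dj := (mem_occ.1 hv₂ _).2 hb₂
    have z : ∀ x y, d (bm x) v₂ = 0 → d (bm x) (d y v₂) = 0 := by
      intro x y hx
      rw [h.dd, hx, map_zero, neg_zero]
    simp only [LinearMap.add_apply, Module.End.mul_apply, map_add]
    simp [h.dc, hij, hij.symm, z _ _ di, z _ _ dj, ei, ej, two_smul]
  have := S.smul_mem (2 : ℂ)⁻¹ (hS _ (.raise i j hij) _ hlow)
  rwa [e, smul_smul, inv_mul_cancel₀ two_ne_zero, one_smul] at this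

/-- A sector which is neither the lowest nor the highest one is generated by the vectors with
`wm` occupied and `Fm` empty. -/
lemma FockRep.mem_of_mem_sector (h : FockRep c d num vac) (S : Submodule ℂ W)
    (hS : ∀ X, SymOp c d X → ∀ v ∈ S, X v ∈ S) (k : ℕ) (hk0 : 1 ≤ k)
    (hk1 : k ≤ 2 * Fintype.card P + 1)
    (hbase : ∀ s v, s wm = true → s Fm = false → v ∈ occ c d s → num v = (k : ℂ) • v → v ∈ S)
    (v : W) (hv : num v = (k : ℂ) • v) : v ∈ S := by
  have hle : LinearMap.ker (num - (k : ℂ) • 1) ≤ S := by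
    refine h.le_of_occ_le _ _ (fun p v hv => ?_) fun s v hv hs => ?_
    · rw [LinearMap.mem_ker, LinearMap.sub_apply, sub_eq_zero] at hv ⊢
      exact h.num_cd hv p p
    rw [LinearMap.mem_ker, LinearMap.sub_apply, sub_eq_zero] at hv
    replace hv : num v = (k : ℂ) • v := hv
    obtain rfl | hv0 := eq_or_ne v 0
    · exact S.zero_mem
    have hcount := h.count_eq hs hv0 hv
    have up : s wm = false → ∀ p, p ≠ wm → s p = true → SymOp c d (c p * d wm) →
        (p = Fm ∨ s Fm = false) → v ∈ S := by
      intro hw p hpw hp hX hF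
      have e : v = (c p * d wm) (c wm (d p v)) := by
        rw [Module.End.mul_apply, h.dc, if_pos rfl, h.dd, (mem_occ.1 hs wm).2 hw]
        simp [h.cd_of_c_eq_zero ((mem_occ.1 hs p).1 hp)]
      rw [e]
      refine hS _ hX _ (hbase _ _ ?_ ?_ (h.c_mem_occ (h.d_mem_occ hs p) wm) (h.num_cd hv _ _))
      · simp
      · rw [Function.update_of_ne (by simp)]
        obtain rfl | hF := hF
        · simp
        · rw [Function.update_apply, hF, ite_self]
    cases hw : s wm <;> cases hF : s Fm
    · have hpos : 0 < ∑ i, ((s (am i)).toNat + (s (bm i)).toNat) := by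
        rw [count_pairs, hw, hF] at hcount
        simp only [Bool.toNat_false] at hcount
        omega
      obtain ⟨i, -, hi⟩ := Finset.exists_ne_zero_of_sum_ne_zero hpos.ne'
      cases ha : s (am i)
      · cases hb : s (bm i)
        · simp [ha, hb] at hi
        · exact up hw (bm i) (by simp) hb (.toPair i true) (.inr hF)
      · exact up hw (am i) (by simp) ha (.toPair i false) (.inr hF)
    · exact up hw Fm (by simp) hF .special (.inl rfl)
    · exact hbase s v hw hF hs hv
    · have down : ∀ i β, s (some i, β) = false → v ∈ S := by
        intro i β hp
        have e : v = (c Fm * d (some i, β)) (c (some i, β) (d Fm v)) := by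
          rw [Module.End.mul_apply, h.dc, if_pos rfl, h.dd, (mem_occ.1 hs _).2 hp]
          simp [h.cd_of_c_eq_zero ((mem_occ.1 hs Fm).1 hF)]
        rw [e]
        refine hS _ (.fromPair i β) _
          (hbase _ _ ?_ ?_ (h.c_mem_occ (h.d_mem_occ hs Fm) _) (h.num_cd hv _ _))
        · simp [hw]
        · simp
      obtain ⟨i, hi⟩ : ∃ i, s (am i) = false ∨ s (bm i) = false := by
        by_contra! hcon
        rw [count_pairs, hw, hF] at hcount
        simp only [Bool.not_eq_false] at hcon
        simp only [hcon] at hcount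
        simp at hcount
        omega
      obtain hi | hi := hi
      · exact down i false hi
      · exact down i true hi
  exact hle (by simp [hv])

end Pairs

section Johnson

variable {J : Type*} [Fintype J] [DecidableEq J]

/-- The symmetric group acts transitively on pairs of subsets with given cardinalities. -/
lemma exists_perm_map {B C B' C' : Finset J} (h1 : B.card = B'.card) (h2 : C.card = C'.card)
    (h3 : (B ∩ C).card = (B' ∩ C').card) :
    ∃ σ : Equiv.Perm J, B.map σ.toEmbedding = B' ∧ C.map σ.toEmbedding = C' := by
  have key : ∀ y : Bool × Bool,
      Nonempty ({x // (decide (x ∈ B), decide (x ∈ C)) = y} ≃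
        {x // (decide (x ∈ B'), decide (x ∈ C')) = y}) := by
    have hB : (B \ C).card = (B' \ C').card := by
      have := Finset.card_sdiff_add_card_inter B C
      have := Finset.card_sdiff_add_card_inter B' C'
      omega
    have hC : (C \ B).card = (C' \ B').card := by
      have := Finset.card_sdiff_add_card_inter C B
      have := Finset.card_sdiff_add_card_inter C' B'
      rw [Finset.inter_comm] at this
      rw [Finset.inter_comm C B] at *
      omega
    have hU : (B ∪ C)ᶜ.card = (B' ∪ C')ᶜ.card := by
      rw [Finset.card_compl, Finset.card_compl]
      have := Finset.card_union_add_card_inter B C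
      have := Finset.card_union_add_card_inter B' C'
      omega
    rintro ⟨β, γ⟩
    refine ⟨Fintype.equivOfCardEq ?_⟩
    rw [Fintype.card_subtype, Fintype.card_subtype]
    cases β <;> cases γ
    · convert hU using 2 <;> ext x <;> simp
    · convert hC using 2 <;> ext x <;> simp [and_comm]
    · convert hB using 2 <;> ext x <;> simp
    · convert h3 using 2 <;> ext x <;> simp
  have e := fun y => Classical.choice (key y)
  let σ : Equiv.Perm J := (Equiv.sigmaFiberEquiv _).symm.trans
    ((Equiv.sigmaCongrRight e).trans (Equiv.sigmaFiberEquiv _))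
  have hσ : ∀ x, (decide (σ x ∈ B'), decide (σ x ∈ C')) = (decide (x ∈ B), decide (x ∈ C)) :=
    fun x => (e _ ⟨x, rfl⟩).2
  simp only [Prod.mk.injEq, decide_eq_decide] at hσ
  refine ⟨σ, ?_, ?_⟩ <;> ext x <;> rw [Finset.mem_map_equiv]
  · rw [← (hσ (σ.symm x)).1, Equiv.apply_symm_apply]
  · rw [← (hσ (σ.symm x)).2, Equiv.apply_symm_apply]

/-- A matrix on subsets which is invariant under transpositions is a combination of binomial
coefficients of the intersection sizes. -/
lemma exists_choose_expansion (g : Finset J → Finset J → ℂ)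
    (hg : ∀ i j, i ≠ j → ∀ B C, g (B.map (Equiv.swap i j).toEmbedding)
      (C.map (Equiv.swap i j).toEmbedding) = g B C) (m : ℕ) :
    ∃ α : ℕ → ℕ → ℂ, ∀ B C, B.card = m →
      g B C = ∑ b ∈ Finset.range (m + 1), α C.card b * ((B ∩ C).card.choose b : ℂ) := by
  have hσ : ∀ σ : Equiv.Perm J, ∀ B C,
      g (B.map σ.toEmbedding) (C.map σ.toEmbedding) = g B C := by
    intro σ
    induction σ using Equiv.Perm.swap_induction_on with
    | one =>
      intro B C
      congr 1 <;> exact Finset.map_refl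
    | swap_mul σ i j hij ih =>
      intro B C
      have hm : ∀ B : Finset J, B.map (Equiv.swap i j * σ).toEmbedding =
          (B.map σ.toEmbedding).map (Equiv.swap i j).toEmbedding := fun B => by
        rw [Finset.map_map]; rfl
      rw [hm, hm, hg i j hij, ih]
  have hcard : ∀ B C B' C', B.card = B'.card → C.card = C'.card →
      (B ∩ C).card = (B' ∩ C').card → g B C = g B' C' := by
    intro B C B' C' h1 h2 h3
    obtain ⟨σ, rfl, rfl⟩ := exists_perm_map h1 h2 h3
    exact (hσ σ B C).symm
  classical
  let G : ℕ → ℕ → ℂ := fun r x =>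
    if h : ∃ BC : Finset J × Finset J, BC.1.card = m ∧ BC.2.card = r ∧ (BC.1 ∩ BC.2).card = x then
      g h.choose.1 h.choose.2 else 0
  refine ⟨fun r b => (fwdDiff 1)^[b] (G r) 0, fun B C hB => ?_⟩
  have hG : g B C = G C.card (B ∩ C).card := by
    have h : ∃ BC : Finset J × Finset J, BC.1.card = m ∧ BC.2.card = C.card ∧
      (BC.1 ∩ BC.2).card = (B ∩ C).card := ⟨(B, C), hB, rfl, rfl⟩
    simp only [G, dif_pos h]
    exact hcard _ _ _ _ (hB.trans h.choose_spec.1.symm) h.choose_spec.2.1.symm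
      h.choose_spec.2.2.symm
  have hle : (B ∩ C).card ≤ m := hB ▸ Finset.card_le_card Finset.inter_subset_left
  have := shift_eq_sum_fwdDiff_iter 1 (G C.card) (B ∩ C).card 0
  simp only [smul_eq_mul, mul_one, zero_add] at this
  rw [hG, this]
  refine (Finset.sum_subset (Finset.range_mono (by omega)) fun b _ hb => ?_).trans
    (Finset.sum_congr rfl fun b _ => ?_)
  · rw [Nat.choose_eq_zero_of_lt (by simpa using hb)]; simp
  · rw [nsmul_eq_mul, mul_comm]

variable {W : Type*} [AddCommGroup W] [Module ℂ W] {v : Finset J → W}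

lemma raise_pow {U : Module.End ℂ W} (hU : ∀ C, U (v C) = ∑ j ∈ Cᶜ, v (insert j C))
    (i : ℕ) (B : Finset J) : (U ^ i) (v B) = (i.factorial : ℂ) •
      ∑ C ∈ Finset.univ.filter (fun C => B ⊆ C ∧ C.card = B.card + i), v C := by
  induction i with
  | zero =>
    have : Finset.univ.filter (fun C => B ⊆ C ∧ C.card = B.card + 0) = {B} := by
      ext C
      simp only [add_zero, Finset.mem_filter, Finset.mem_univ, true_and, Finset.mem_singleton]
      exact ⟨fun h => (Finset.eq_of_subset_of_card_le h.1 h.2.le).symm, fun h => by simp [h]⟩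
    rw [this]
    simp
  | succ i ih =>
    rw [pow_succ', Module.End.mul_apply, ih, map_smul, map_sum, Nat.factorial_succ, mul_comm,
      Nat.cast_mul, mul_smul]
    congr 1
    simp only [hU]
    have : ∀ D : Finset J, D ∈ Finset.univ.filter (fun C => B ⊆ C ∧ C.card = B.card + (i + 1)) →
        ((i + 1 : ℕ) : ℂ) • v D = ∑ j ∈ D \ B, v D := by
      intro D hD
      simp only [Finset.mem_filter, Finset.mem_univ, true_and] at hD
      rw [Finset.sum_const, Finset.card_sdiff_of_subset hD.1, hD.2, Nat.cast_smul_eq_nsmul]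
      congr 1
      omega
    rw [Finset.smul_sum, Finset.sum_congr rfl this, Finset.sum_sigma', Finset.sum_sigma']
    refine Finset.sum_bij' (fun x _ => ⟨insert x.2 x.1, x.2⟩) (fun x _ => ⟨x.1.erase x.2, x.2⟩)
      ?_ ?_ ?_ ?_ ?_
    · rintro ⟨C, j⟩ h
      simp only [Finset.mem_sigma, Finset.mem_filter, Finset.mem_univ, true_and,
        Finset.mem_compl] at h
      simp only [Finset.mem_sigma, Finset.mem_filter, Finset.mem_univ, true_and,
        Finset.mem_sdiff, Finset.mem_insert_self, Finset.card_insert_of_notMem h.2]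
      exact ⟨⟨h.1.1.trans (Finset.subset_insert _ _), by omega⟩, fun hj => h.2 (h.1.1 hj)⟩
    · rintro ⟨C, j⟩ h
      simp only [Finset.mem_sigma, Finset.mem_filter, Finset.mem_univ, true_and,
        Finset.mem_sdiff] at h
      simp only [Finset.mem_sigma, Finset.mem_filter, Finset.mem_univ, true_and,
        Finset.mem_compl, Finset.card_erase_of_mem h.2.1]
      exact ⟨⟨Finset.subset_erase.2 ⟨h.1.1, h.2.2⟩, by omega⟩, Finset.notMem_erase _ _⟩
    · rintro ⟨C, j⟩ h
      simp only [Finset.mem_sigma, Finset.mem_compl] at h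
      simp [Finset.erase_insert h.2]
    · rintro ⟨C, j⟩ h
      simp only [Finset.mem_sigma, Finset.mem_sdiff] at h
      simp [Finset.insert_erase h.2.1]
    · simp

lemma lower_pow {D : Module.End ℂ W} (hD : ∀ C, D (v C) = ∑ j ∈ C, v (C.erase j))
    (i : ℕ) (B : Finset J) : (D ^ i) (v B) = (i.factorial : ℂ) •
      ∑ C ∈ Finset.univ.filter (fun C => C ⊆ B ∧ C.card + i = B.card), v C := by
  have h := raise_pow (v := fun C => v Cᶜ) (U := D) (fun C => by
    rw [hD]; exact Finset.sum_congr rfl fun j _ => by rw [Finset.compl_insert]) i Bᶜ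
  simp only [compl_compl] at h
  rw [h]
  congr 1
  refine Finset.sum_bij' (fun C _ => Cᶜ) (fun C _ => Cᶜ) ?_ ?_ (by simp) (by simp) (by simp)
  · intro C hC
    simp only [Finset.mem_filter, Finset.mem_univ, true_and, Finset.card_compl] at hC ⊢
    have := Finset.card_le_univ C
    have := Finset.card_le_univ B
    exact ⟨compl_le_iff_compl_le.1 hC.1, by omega⟩
  · intro C hC
    simp only [Finset.mem_filter, Finset.mem_univ, true_and, Finset.card_compl] at hC ⊢
    have := Finset.card_le_univ C
    have := Finset.card_le_univ B
    exact ⟨compl_le_compl hC.1, by omega⟩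

lemma raise_lower {U D : Module.End ℂ W} (hU : ∀ C, U (v C) = ∑ j ∈ Cᶜ, v (insert j C))
    (hD : ∀ C, D (v C) = ∑ j ∈ C, v (C.erase j)) {r m b : ℕ} (hbm : b ≤ m) (hbr : b ≤ r)
    (B : Finset J) (hB : B.card = m) :
    ((((r - b).factorial * (m - b).factorial : ℕ) : ℂ)⁻¹) • (U ^ (r - b)) ((D ^ (m - b)) (v B)) =
      ∑ C ∈ Finset.univ.filter (fun C : Finset J => C.card = r),
        ((B ∩ C).card.choose b : ℂ) • v C := by
  have hne : ((r - b).factorial * (m - b).factorial : ℂ) ≠ 0 := by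
    exact_mod_cast mul_ne_zero (Nat.factorial_ne_zero _) (Nat.factorial_ne_zero _)
  rw [lower_pow hD, map_smul, map_sum, Finset.sum_congr rfl fun C _ => raise_pow hU (r - b) C,
    ← Finset.smul_sum, smul_smul, smul_smul, Nat.cast_mul, mul_assoc,
    mul_comm ((m - b).factorial : ℂ), inv_mul_cancel₀ hne, one_smul, Finset.sum_sigma']
  have : ∀ C : Finset J, ((B ∩ C).card.choose b : ℂ) • v C =
      ∑ A ∈ (B ∩ C).powersetCard b, v C := by
    intro C
    rw [Finset.sum_const, Finset.card_powersetCard, Nat.cast_smul_eq_nsmul]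
  rw [Finset.sum_congr rfl fun C _ => this C, Finset.sum_sigma']
  refine Finset.sum_bij' (fun x _ => ⟨x.2, x.1⟩) (fun x _ => ⟨x.2, x.1⟩) ?_ ?_ (by simp) (by simp)
    (by simp)
  · rintro ⟨A, C⟩ h
    simp only [Finset.mem_sigma, Finset.mem_filter, Finset.mem_univ, true_and,
      Finset.mem_powersetCard, Finset.subset_inter_iff] at h ⊢
    exact ⟨by omega, ⟨h.1.1, h.2.1⟩, by omega⟩
  · rintro ⟨C, A⟩ h
    simp only [Finset.mem_sigma, Finset.mem_filter, Finset.mem_univ, true_and,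
      Finset.mem_powersetCard, Finset.subset_inter_iff] at h ⊢
    exact ⟨⟨h.2.1.1, by omega⟩, h.2.1.2, by omega⟩

/-- Matrices on subsets invariant under transpositions are polynomials in the raising and lowering
operators. -/
lemma exists_raise_lower {U D : Module.End ℂ W} (hU : ∀ C, U (v C) = ∑ j ∈ Cᶜ, v (insert j C))
    (hD : ∀ C, D (v C) = ∑ j ∈ C, v (C.erase j)) (g : Finset J → Finset J → ℂ)
    (hg : ∀ i j, i ≠ j → ∀ B C, g (B.map (Equiv.swap i j).toEmbedding)
      (C.map (Equiv.swap i j).toEmbedding) = g B C) {m : ℕ} (hm : m ≤ Fintype.card J) :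
    ∃ A ∈ Submodule.span ℂ {X | ∃ i ≤ Fintype.card J, ∃ j ≤ Fintype.card J, X = U ^ i * D ^ j},
      ∀ B, B.card = m → ∑ C, g B C • v C = A (v B) := by
  obtain ⟨α, hα⟩ := exists_choose_expansion g hg m
  let c : ℕ → ℕ → ℂ := fun r b => if b ≤ r then
    α r b * (((r - b).factorial * (m - b).factorial : ℕ) : ℂ)⁻¹ else 0
  refine ⟨∑ r ∈ Finset.range (Fintype.card J + 1), ∑ b ∈ Finset.range (m + 1),
    c r b • (U ^ (r - b) * D ^ (m - b)), Submodule.sum_mem _ fun r hr => Submodule.sum_mem _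
      fun b hb => Submodule.smul_mem _ _ (Submodule.subset_span ⟨r - b, ?_, m - b, by omega, rfl⟩),
    fun B hB => ?_⟩
  · simp only [Finset.mem_range] at hr
    omega
  · have hfib : ∑ C, g B C • v C = ∑ r ∈ Finset.range (Fintype.card J + 1),
        ∑ C ∈ Finset.univ.filter (fun C : Finset J => C.card = r), g B C • v C :=
      (Finset.sum_fiberwise_of_maps_to (fun C _ => by
        simpa [Nat.lt_succ_iff] using Finset.card_le_univ C) _).symm
    rw [hfib, LinearMap.sum_apply]
    refine Finset.sum_congr rfl fun r _ => ?_
    rw [LinearMap.sum_apply]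
    have h1 : ∀ b ∈ Finset.range (m + 1), (c r b • (U ^ (r - b) * D ^ (m - b))) (v B) =
        ∑ C ∈ Finset.univ.filter (fun C : Finset J => C.card = r),
          (α r b * ((B ∩ C).card.choose b : ℂ)) • v C := by
      intro b hb
      simp only [Finset.mem_range, Nat.lt_succ_iff] at hb
      by_cases hbr : b ≤ r
      · simp only [c, if_pos hbr, mul_smul, LinearMap.smul_apply, Module.End.mul_apply]
        rw [raise_lower hU hD hb hbr B hB, Finset.smul_sum]
      · simp only [c, if_neg hbr, zero_smul, LinearMap.zero_apply]
        refine (Finset.sum_eq_zero fun C hC => ?_).symm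
        simp only [Finset.mem_filter, Finset.mem_univ, true_and] at hC
        have : (B ∩ C).card ≤ C.card := Finset.card_le_card Finset.inter_subset_right
        rw [Nat.choose_eq_zero_of_lt (by omega)]
        simp
    rw [Finset.sum_congr rfl h1, Finset.sum_comm]
    refine Finset.sum_congr rfl fun C hC => ?_
    simp only [Finset.mem_filter, Finset.mem_univ, true_and] at hC
    rw [hα B C hB, Finset.sum_smul, hC]

end Johnson

section Bilinear

variable {ι W : Type*} [DecidableEq ι] [AddCommGroup W] [Module ℂ W]
  {c d : ι → Module.End ℂ W}

/-- The commutation relations of the bilinears `c p * d q`. -/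
lemma CAR.bilinear (h : CAR c d) (p q r s : ι) (v : W) :
    c p (d q (c r (d s v))) = c r (d s (c p (d q v))) + (if q = r then c p (d s v) else 0)
      - (if s = p then c r (d q v) else 0) := by
  rw [h.dc q r, h.dc s p, map_sub, map_sub, h.cc p r, h.dd q s]
  split_ifs <;> simp <;> abel

lemma CAR.bilinear_num (h : CAR c d) (q r p : ι) (v : W) :
    c q (d r (c p (d p v))) = c p (d p (c q (d r v))) +
      ((if r = p then 1 else 0) - if p = q then 1 else 0 : ℂ) • c q (d r v) := by
  rw [h.bilinear]
  split_ifs with h1 h2 h2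
  · subst h1; subst h2; simp
  · subst h1; simp
  · subst h2; simp [sub_eq_add_neg]
  · simp

lemma CAR.c_d_eq_zero (h : CAR c d) {p q : ι} (hpq : q ≠ p) {v : W} (hv : c p v = 0) :
    c p (d q v) = 0 := by
  have := h.dc q p v
  rwa [hv, map_zero, if_neg hpq, zero_sub, eq_comm, neg_eq_zero] at this

lemma CAR.cd_of_mem_occ (h : CAR c d) {s : ι → Bool} {v : W} (hv : v ∈ occ c d s) (p : ι) :
    c p (d p v) = if s p then v else 0 := by
  have := mem_occ.1 hv p
  cases hs : s p
  · simp [this.2 hs]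
  · simp [h.cd_of_c_eq_zero (this.1 hs)]

/-- If `c p * d q` annihilates a nonzero vector with definite occupation numbers, then `q` is empty
or `p` is occupied. -/
lemma CAR.of_cd_eq_zero (h : CAR c d) {s : ι → Bool} {v : W} (hv : v ∈ occ c d s) (hv0 : v ≠ 0)
    {p q : ι} (h0 : c p (d q v) = 0) : s q = false ∨ s p = true := by
  by_contra! hcon
  have hq : s q = true := by simpa using hcon.1
  have hp : s p = false := by simpa using hcon.2
  apply hv0
  rw [← h.cd_of_c_eq_zero ((mem_occ.1 hv q).1 hq)]
  have hpd : d p (d q v) = 0 := by rw [h.dd, (mem_occ.1 hv p).2 hp]; simp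
  rw [← h.dc_of_d_eq_zero hpd, h0, map_zero, map_zero]

/-- Nonzero vectors with distinct occupation numbers are linearly independent. -/
lemma CAR.linearIndependent [Fintype ι] (h : CAR c d) {κ : Type*} [Fintype κ]
    {s : κ → ι → Bool} (hs : Function.Injective s) {w : κ → W} (hw : ∀ x, w x ∈ occ c d (s x))
    (hw0 : ∀ x, w x ≠ 0) : LinearIndependent ℂ w := by
  rw [Fintype.linearIndependent_iff]
  intro g hg x
  obtain ⟨π, hπ, hπ'⟩ := h.exists_proj (s x)
  have := congrArg π hg
  rw [map_sum, map_zero, Finset.sum_eq_single x] at this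
  · rw [map_smul, hπ _ (hw x)] at this
    exact (smul_eq_zero.1 this).resolve_right (hw0 x)
  · intro y _ hy
    rw [map_smul, hπ' _ (fun e => hy (hs e)) _ (hw y), smul_zero]
  · simp

end Bilinear

section Family

variable {P J W : Type*} [DecidableEq P] [AddCommGroup W] [Module ℂ W]

/-- The occupation numbers `s` with the pairs `e j`, `j ∈ C`, filled. -/
def filled (s : Mode P → Bool) (e : J → P) (C : Finset J) : Mode P → Bool :=
  fun p => s p || decide (∃ j ∈ C, p.1 = some (e j))

lemma filled_none (s : Mode P → Bool) (e : J → P) (β : Bool) (C : Finset J) :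
    filled s e C (none, β) = s (none, β) := by
  simp [filled]

lemma filled_of_ne (s : Mode P → Bool) {e : J → P} (C : Finset J) {i : P} (hi : ∀ j, e j ≠ i)
    (β : Bool) : filled s e C (some i, β) = s (some i, β) := by
  simp [filled, fun j => (hi j).symm]

variable [DecidableEq J]

/-- Vectors obtained by filling the empty pairs `e j` of a vector with occupation numbers `s`, all
other pairs of which are singly occupied. -/
structure PairFamily (c d : Mode P → Module.End ℂ W) (s : Mode P → Bool) (e : J → P)
    (v : Finset J → W) : Prop where
  inj : Function.Injective e
  occ_wm : s wm = true
  occ_Fm : s Fm = false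
  empty : ∀ j β, s (some (e j), β) = false
  single : ∀ i, (∀ j, e j ≠ i) → s (am i) ≠ s (bm i)
  mem : ∀ C, v C ∈ occ c d (filled s e C)
  ne : ∀ C, v C ≠ 0
  raise : ∀ C j, j ∉ C → c (am (e j)) (c (bm (e j)) (v C)) = v (insert j C)

variable {c d : Mode P → Module.End ℂ W} {s : Mode P → Bool} {e : J → P} {v : Finset J → W}

lemma filled_insert (C : Finset J) (j : J) : filled s e (insert j C) =
      Function.update (Function.update (filled s e C) (bm (e j)) true) (am (e j)) true := by
  funext p
  obtain ⟨p, β⟩ := p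
  by_cases hp : p = some (e j)
  · subst hp
    cases β <;> simp [filled]
  · rw [Function.update_of_ne (by simp [hp]), Function.update_of_ne (by simp [hp])]
    simp [filled, hp]

lemma filled_some (he : Function.Injective e) (hs : ∀ j β, s (some (e j), β) = false)
    (C : Finset J) (j : J) (β : Bool) : filled s e C (some (e j), β) = decide (j ∈ C) := by
  simp [filled, hs, he.eq_iff]

lemma CAR.exists_pairFamily (h : CAR c d) (he : Function.Injective e) (hw : s wm = true)
    (hF : s Fm = false) (hs : ∀ j β, s (some (e j), β) = false)
    (hsing : ∀ i, (∀ j, e j ≠ i) → s (am i) ≠ s (bm i)) {v₀ : W} (hv₀ : v₀ ∈ occ c d s)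
    (hne : v₀ ≠ 0) : ∃ v : Finset J → W, PairFamily c d s e v := by
  have hcomm : ∀ i j, Commute (c (am (e i)) * c (bm (e i))) (c (am (e j)) * c (bm (e j))) := by
    intro i j
    refine LinearMap.ext fun v => ?_
    simp only [Module.End.mul_apply]
    rw [h.cc (bm (e i)), h.cc (bm (e i)) (bm (e j)), map_neg, map_neg, map_neg, neg_neg,
      h.cc (am (e i)), h.cc (am (e i)) (bm (e j)), map_neg, neg_neg]
  have hpw : ∀ C : Finset J, (C : Set J).Pairwise
      (Function.onFun Commute fun j => c (am (e j)) * c (bm (e j))) :=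
    fun C i _ j _ _ => hcomm i j
  let v : Finset J → W := fun C => C.noncommProd _ (hpw C) v₀
  have hraise : ∀ C j, j ∉ C → c (am (e j)) (c (bm (e j)) (v C)) = v (insert j C) := by
    intro C j hj
    simp only [v]
    rw [Finset.noncommProd_insert_of_notMem _ _ _ _ hj]
    rfl
  have hmem : ∀ C, v C ∈ occ c d (filled s e C) := by
    intro C
    induction C using Finset.induction_on with
    | empty =>
      have : filled s e ∅ = s := by funext p; simp [filled]
      simpa [v, this] using hv₀
    | insert j C hj ih =>
      rw [← hraise C j hj, filled_insert]
      exact h.c_mem_occ (h.c_mem_occ ih _) _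
  refine ⟨v, he, hw, hF, hs, hsing, hmem, fun C => ?_, hraise⟩
  induction C using Finset.induction_on with
  | empty => simpa [v] using hne
  | insert j C hj ih =>
    rw [← hraise C j hj]
    have ha := (mem_occ.1 (hmem C) (am (e j))).2 (by simp [filled_some he hs, hj])
    have hb := (mem_occ.1 (hmem C) (bm (e j))).2 (by simp [filled_some he hs, hj])
    have ha' : d (am (e j)) (c (bm (e j)) (v C)) = 0 := by simp [h.dc, ha]
    intro h0
    apply ih
    rw [← h.dc_of_d_eq_zero hb, ← h.dc_of_d_eq_zero ha', h0, map_zero, map_zero]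

namespace PairFamily

lemma c_eq_zero (hv : PairFamily c d s e v) {C : Finset J} {j : J}
    (hj : j ∈ C) (β : Bool) : c (some (e j), β) (v C) = 0 :=
  (mem_occ.1 (hv.mem C) _).1 (by simp [filled_some hv.inj hv.empty, hj])

lemma d_eq_zero (hv : PairFamily c d s e v) {C : Finset J} {j : J}
    (hj : j ∉ C) (β : Bool) : d (some (e j), β) (v C) = 0 :=
  (mem_occ.1 (hv.mem C) _).2 (by simp [filled_some hv.inj hv.empty, hj])

lemma lower (h : CAR c d) (hv : PairFamily c d s e v) {C : Finset J} {j : J} (hj : j ∈ C) :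
    d (bm (e j)) (d (am (e j)) (v C)) = v (C.erase j) := by
  have hj' : j ∉ C.erase j := Finset.notMem_erase _ _
  rw [← Finset.insert_erase hj, ← hv.raise _ _ hj', Finset.erase_insert hj',
    h.dc_of_d_eq_zero, h.dc_of_d_eq_zero (hv.d_eq_zero hj' true)]
  simp [h.dc, hv.d_eq_zero hj' false]

/-- The exchange of two pairs is implemented by a polynomial in the symmetry generators. -/
lemma exchange (h : CAR c d) (hv : PairFamily c d s e v) {i j : J} (hij : i ≠ j) (C : Finset J) :
    v C - (c (bm (e i)) * d (am (e j)) + c (bm (e j)) * d (am (e i)))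
      ((c (am (e i)) * d (bm (e j)) + c (am (e j)) * d (bm (e i))) (v C)) =
    v (C.map (Equiv.swap i j).toEmbedding) := by
  have hne : e i ≠ e j := hv.inj.ne hij
  have key : ∀ i j, i ≠ j → ∀ C, i ∈ C → j ∉ C →
      v C - (c (bm (e i)) * d (am (e j)) + c (bm (e j)) * d (am (e i)))
      ((c (am (e i)) * d (bm (e j)) + c (am (e j)) * d (bm (e i))) (v C)) =
      v (insert j (C.erase i)) := by
    intro i j hij C hi hj
    have hne : e i ≠ e j := hv.inj.ne hij
    have hi' : i ∉ C.erase i := Finset.notMem_erase _ _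
    have hj' : j ∉ C.erase i := fun h => hj (Finset.mem_of_mem_erase h)
    have e0 := hv.d_eq_zero hi' false
    have e1 := hv.d_eq_zero hi' true
    have e2 := hv.d_eq_zero hj' false
    have e3 := hv.d_eq_zero hj' true
    rw [← Finset.insert_erase hi, ← hv.raise _ _ hi', Finset.erase_insert hi', ← hv.raise _ _ hj']
    simp [h.dc, e0, e1, e2, e3, hne, hne.symm]
    rw [h.cc (bm (e i)) (am (e i)), h.cc (bm (e j)) (am (e j))]
    abel
  by_cases hi : i ∈ C <;> by_cases hj : j ∈ C
  · have : C.map (Equiv.swap i j).toEmbedding = C := by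
      ext x
      rw [Finset.mem_map_equiv, Equiv.symm_swap, Equiv.swap_apply_def]
      split_ifs with h1 h2 <;> simp_all
    rw [this]
    have h0 : ∀ i j : J, i ∈ C → c (am (e i)) (d (bm (e j)) (v C)) = 0 := fun i j hi =>
      h.c_d_eq_zero (by simp) (hv.c_eq_zero hi false)
    simp [h0 i j hi, h0 j i hj]
  · have : C.map (Equiv.swap i j).toEmbedding = insert j (C.erase i) := by
      ext x
      rw [Finset.mem_map_equiv, Equiv.symm_swap, Equiv.swap_apply_def]
      split_ifs with h1 h2 <;> simp_all
    rw [this, key i j hij C hi hj]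
  · have : C.map (Equiv.swap i j).toEmbedding = insert i (C.erase j) := by
      ext x
      rw [Finset.mem_map_equiv, Equiv.symm_swap, Equiv.swap_apply_def]
      split_ifs with h1 h2 <;> simp_all
    rw [this, ← key j i hij.symm C hj hi, add_comm, add_comm (c (am (e i)) * d (bm (e j)))]
  · have : C.map (Equiv.swap i j).toEmbedding = C := by
      ext x
      rw [Finset.mem_map_equiv, Equiv.symm_swap, Equiv.swap_apply_def]
      split_ifs with h1 h2 <;> simp_all
    rw [this]
    simp [hv.d_eq_zero hi, hv.d_eq_zero hj]

end PairFamily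
end Family

section Family

variable {P J W : Type*} [DecidableEq P] [AddCommGroup W] [Module ℂ W] [DecidableEq J]
  [Fintype J]
  {c d : Mode P → Module.End ℂ W} {num : Module.End ℂ W} {vac : W}
  {s : Mode P → Bool} {e : J → P} {v : Finset J → W}

/-- Occupation numbers with the same pair imbalances as `s` come from filling pairs. -/
lemma exists_filled (he : Function.Injective e) (hs : ∀ j β, s (some (e j), β) = false)
    (hsing : ∀ i, (∀ j, e j ≠ i) → s (am i) ≠ s (bm i)) {s' : Mode P → Bool}
    (h : ∀ i, ((s' (am i)).toNat : ℤ) - (s' (bm i)).toNat = (s (am i)).toNat - (s (bm i)).toNat) :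
    ∃ C : Finset J, ∀ i β, s' (some i, β) = filled s e C (some i, β) := by
  refine ⟨Finset.univ.filter fun j => s' (am (e j)) = true, fun i β => ?_⟩
  by_cases hi : ∀ j, e j ≠ i
  · rw [filled_of_ne _ _ hi]
    have := hsing i hi
    have := h i
    cases h1 : s (am i) <;> cases h2 : s (bm i) <;> cases h3 : s' (am i) <;>
      cases h4 : s' (bm i) <;> cases β <;> simp_all
  · push Not at hi
    obtain ⟨j, rfl⟩ := hi
    rw [filled_some he hs]
    have := h (e j)
    rw [hs, hs] at this
    cases h3 : s' (am (e j)) <;> cases h4 : s' (bm (e j)) <;> cases β <;> simp_all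

variable [Fintype P]

lemma sing_filled (he : Function.Injective e) (hs : ∀ j β, s (some (e j), β) = false)
    (C : Finset J) : sing (filled s e C) = sing s := by
  ext i
  simp only [sing, Finset.mem_filter, Finset.mem_univ, true_and]
  by_cases hi : ∀ j, e j ≠ i
  · rw [filled_of_ne _ _ hi, filled_of_ne _ _ hi]
  · push Not at hi
    obtain ⟨j, rfl⟩ := hi
    simp [filled_some he hs, hs]

/-- The image of a vector of the family under an intertwiner. -/
lemma PairFamily.exists_expansion (h : FockRep c d num vac) (hv : PairFamily c d s e v)
    {T : Module.End ℂ W} (hT : ∀ X, SymOp c d X → ∀ u, T (X u) = X (T u)) {k k' : ℕ}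
    (hpar : k % 2 = k' % 2) {C : Finset J} (hk : num (v C) = (k : ℂ) • v C)
    (hk' : num (T (v C)) = (k' : ℂ) • T (v C)) :
    ∃ (τ : ℂ) (g : Finset J → ℂ),
      T (v C) = τ • v C + ∑ C', g C' • c Fm (d wm (v C')) := by
  have hcar := h.toCAR
  let χ : P → ℂ := fun i => (s (am i)).toNat - (s (bm i)).toNat
  let Q : Submodule ℂ W :=
    { carrier := {u | num u = (k' : ℂ) • u ∧
        (∀ i, c (am i) (d (am i) u) - c (bm i) (d (bm i) u) = χ i • u) ∧
        (∀ j ∈ C, ∀ β, c (some (e j), β) (d wm u) = 0) ∧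
        ∀ j ∉ C, ∀ β, c Fm (d (some (e j), β) u) = 0}
      zero_mem' := by simp
      add_mem' := by
        rintro x y ⟨h1, h2, h3, h4⟩ ⟨h1', h2', h3', h4'⟩
        refine ⟨by simp [h1, h1'], fun i => ?_, fun j hj β => by simp [h3 j hj, h3' j hj],
          fun j hj β => by simp [h4 j hj, h4' j hj]⟩
        rw [smul_add, ← h2, ← h2']
        simp only [map_add]
        abel
      smul_mem' := by
        rintro t x ⟨h1, h2, h3, h4⟩
        refine ⟨by rw [map_smul, h1, smul_comm], fun i => ?_, fun j hj β => by simp [h3 j hj],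
          fun j hj β => by simp [h4 j hj]⟩
        rw [smul_comm, ← h2]
        simp only [map_smul, smul_sub] }
  let S : Submodule ℂ W :=
    Submodule.span ℂ {v C} ⊔ Submodule.span ℂ (Set.range fun C' => c Fm (d wm (v C')))
  have hQS : Q ≤ S := by
    refine hcar.le_of_occ_le Q S ?_ ?_
    · rintro p u ⟨h1, h2, h3, h4⟩
      refine ⟨h.num_cd h1 p p, fun i => ?_, fun j hj β => ?_, fun j hj β => ?_⟩
      · rw [hcar.bilinear_num, hcar.bilinear_num (bm i)]
        simp only [eq_comm (a := p), sub_self, zero_smul, add_zero]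
        rw [← map_smul, ← map_smul, ← h2, map_sub, map_sub]
      · rw [hcar.bilinear_num, h3 j hj]
        simp
      · rw [hcar.bilinear_num, h4 j hj]
        simp
    · rintro s' u ⟨h1, h2, h3, h4⟩ hu
      obtain rfl | hu0 := eq_or_ne u 0
      · exact S.zero_mem
      have hχ : ∀ i, ((s' (am i)).toNat : ℤ) - (s' (bm i)).toNat =
          (s (am i)).toNat - (s (bm i)).toNat := by
        intro i
        have := h2 i
        have hb : ∀ x : Bool, (if x = true then u else 0) = (x.toNat : ℂ) • u := by
          intro x; cases x <;> simp
        rw [hcar.cd_of_mem_occ hu, hcar.cd_of_mem_occ hu, hb, hb, ← sub_smul] at this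
        have := smul_left_injective ℂ hu0 this
        simp only [χ] at this
        exact_mod_cast this
      obtain ⟨C', hC'⟩ := exists_filled hv.inj hv.empty hv.single hχ
      have hsing : (sing s').card = (sing s).card := by
        rw [← sing_filled hv.inj hv.empty C']
        congr 1
        ext i
        simp [sing, hC']
      have hp' := count_parity s'
      have hp := count_parity (filled s e C)
      rw [h.count_eq hu hu0 h1] at hp'
      rw [h.count_eq (hv.mem C) (hv.ne C) hk, sing_filled hv.inj hv.empty, filled_none,
        filled_none, hv.occ_wm, hv.occ_Fm] at hp
      simp only [Bool.toNat_true, Bool.toNat_false] at hp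
      cases hF : s' Fm <;> cases hw : s' wm <;>
        rw [hF, hw] at hp' <;> simp only [Bool.toNat_true, Bool.toNat_false] at hp'
      · omega
      · have hCC : C' = C := by
          ext j
          have hj' : s' (am (e j)) = decide (j ∈ C') := by
            rw [hC', filled_some hv.inj hv.empty]
          constructor
          · intro hj
            by_contra hcon
            obtain h0 | h0 := hcar.of_cd_eq_zero hu hu0 (h4 j hcon false)
            · simp [hj', hj] at h0
            · simp [hF] at h0
          · intro hj
            obtain h0 | h0 := hcar.of_cd_eq_zero hu hu0 (h3 j hj false)
            · simp [hw] at h0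
            · simpa [hj'] using h0
        have hs' : s' = filled s e C := by
          funext ⟨p, β⟩
          cases p with
          | some i => rw [hC', hCC]
          | none => cases β <;> simp [filled_none, hF, hw, hv.occ_Fm, hv.occ_wm]
        rw [hs'] at hu
        obtain ⟨t, rfl⟩ := h.exists_smul _ _ (hv.mem C) _ hu (hv.ne C)
        exact Submodule.mem_sup_left (Submodule.smul_mem _ _ (Submodule.mem_span_singleton_self _))
      · have hmem := hcar.c_mem_occ (hcar.d_mem_occ (hv.mem C') wm) Fm
        have hs' : s' = Function.update (Function.update (filled s e C') wm false)
            Fm true := by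
          funext ⟨p, β⟩
          cases p with
          | some i =>
            rw [hC', Function.update_of_ne (by simp), Function.update_of_ne (by simp)]
          | none => cases β <;> simp [hF, hw]
        rw [hs'] at hu
        have hne : c Fm (d wm (v C')) ≠ 0 := by
          intro h0
          obtain h1 | h1 := hcar.of_cd_eq_zero (hv.mem C') (hv.ne C') h0
          · simp [filled_none, hv.occ_wm] at h1
          · simp [filled_none, hv.occ_Fm] at h1
        obtain ⟨t, rfl⟩ := h.exists_smul _ _ hmem _ hu hne
        exact Submodule.mem_sup_right (Submodule.smul_mem _ _
          (Submodule.subset_span ⟨C', rfl⟩))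
      · omega
  have hTQ : T (v C) ∈ Q := by
    refine ⟨hk', fun i => ?_, fun j hj β => ?_, fun j hj β => ?_⟩
    · have key : ∀ u, c (am i) (d (am i) u) - c (bm i) (d (bm i) u) =
          (c (am i) * d (bm i)) ((c (bm i) * d (am i)) u) -
            (c (bm i) * d (am i)) ((c (am i) * d (bm i)) u) := by
        intro u
        simp only [Module.End.mul_apply]
        rw [hcar.bilinear (am i) (bm i), if_pos rfl, if_pos rfl]
        abel
      rw [key, ← hT _ (.ba i), ← hT _ (.ab i), ← hT _ (.ab i), ← hT _ (.ba i), ← map_sub, ← key,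
        hcar.cd_of_mem_occ (hv.mem C), hcar.cd_of_mem_occ (hv.mem C), ← map_smul]
      congr 1
      by_cases hi : ∀ j, e j ≠ i
      · simp only [filled_of_ne _ _ hi, χ]
        cases s (am i) <;> cases s (bm i) <;> simp
      · push Not at hi
        obtain ⟨j, rfl⟩ := hi
        simp [filled_some hv.inj hv.empty, hv.empty, χ]
    · have := hT _ (.toPair (e j) β) (v C)
      simp only [Module.End.mul_apply] at this
      rw [← this, hcar.c_d_eq_zero (by simp) (hv.c_eq_zero hj β), map_zero]
    · have := hT _ (.fromPair (e j) β) (v C)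
      simp only [Module.End.mul_apply] at this
      rw [← this, hv.d_eq_zero hj β, map_zero, map_zero]
  obtain ⟨x, hx, y, hy, hxy⟩ := Submodule.mem_sup.1 (hQS hTQ)
  obtain ⟨τ, rfl⟩ := Submodule.mem_span_singleton.1 hx
  obtain ⟨g, rfl⟩ := (Submodule.mem_span_range_iff_exists_fun ℂ).1 hy
  exact ⟨τ, g, hxy.symm⟩

end Family

section Ladder

variable {P J W : Type*} [DecidableEq P] [AddCommGroup W] [Module ℂ W]
  {c d : Mode P → Module.End ℂ W}

lemma CAR.mul_cc (h : CAR c d) (p q : Mode P) : c p * c q = -(c q * c p) :=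
  LinearMap.ext fun v => h.cc p q v

lemma CAR.mul_dd (h : CAR c d) (p q : Mode P) : d p * d q = -(d q * d p) :=
  LinearMap.ext fun v => h.dd p q v

variable [Fintype P]

/-- The pair creation operator. -/
def pairUp (c : Mode P → Module.End ℂ W) : Module.End ℂ W := ∑ i, c (am i) * c (bm i)

/-- The pair annihilation operator. -/
def pairDown (d : Mode P → Module.End ℂ W) : Module.End ℂ W := ∑ i, d (bm i) * d (am i)

/-- The operators of the centralizer in the sectors other than the first and the last. -/
def centOps (c d : Mode P → Module.End ℂ W) : Submodule ℂ (Module.End ℂ W) :=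
  Submodule.span ℂ ({1} ∪ {X | ∃ i ≤ Fintype.card P, ∃ j ≤ Fintype.card P,
    X = c Fm * d wm * (pairUp c ^ i * pairDown d ^ j)})

lemma CAR.pairUp_am (h : CAR c d) (p : Mode P) (i : P) :
    c p * d (am i) * pairUp c = pairUp c * (c p * d (am i)) + c p * c (bm i) := by
  have key : ∀ j, c p * d (am i) * (c (am j) * c (bm j)) =
      c (am j) * c (bm j) * (c p * d (am i)) + if j = i then c p * c (bm i) else 0 := by
    intro j
    ext1 v
    obtain rfl | hj := eq_or_ne j i
    · simp [h.dc, h.cc p (am j), h.cc p (bm j), add_comm]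
    · simp [h.dc, h.cc p (am j), h.cc p (bm j), hj, hj.symm]
  simp only [pairUp, Finset.mul_sum, Finset.sum_mul, key, Finset.sum_add_distrib]
  simp

lemma CAR.pairUp_bm (h : CAR c d) (p : Mode P) (i : P) :
    c p * d (bm i) * pairUp c = pairUp c * (c p * d (bm i)) + c (am i) * c p := by
  have key : ∀ j, c p * d (bm i) * (c (am j) * c (bm j)) =
      c (am j) * c (bm j) * (c p * d (bm i)) + if j = i then c (am i) * c p else 0 := by
    intro j
    ext1 v
    obtain rfl | hj := eq_or_ne j i
    · simp [h.dc, h.cc p (am j), h.cc p (bm j)]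
    · simp [h.dc, h.cc p (am j), h.cc p (bm j), hj, hj.symm]
  simp only [pairUp, Finset.mul_sum, Finset.sum_mul, key, Finset.sum_add_distrib]
  simp

lemma CAR.pairDown_am (h : CAR c d) (q : Mode P) (i : P) :
    c (am i) * d q * pairDown d = pairDown d * (c (am i) * d q) - d (bm i) * d q := by
  have key : ∀ j, c (am i) * d q * (d (bm j) * d (am j)) =
      d (bm j) * d (am j) * (c (am i) * d q) - if j = i then d (bm i) * d q else 0 := by
    intro j
    ext1 v
    obtain rfl | hj := eq_or_ne j i
    · simp [h.dc, h.dd q (am j), h.dd q (bm j)]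
    · simp [h.dc, h.dd q (am j), h.dd q (bm j), hj]
  simp only [pairDown, Finset.mul_sum, Finset.sum_mul, key, Finset.sum_sub_distrib]
  simp

lemma CAR.pairDown_bm (h : CAR c d) (q : Mode P) (i : P) :
    c (bm i) * d q * pairDown d = pairDown d * (c (bm i) * d q) - d q * d (am i) := by
  have key : ∀ j, c (bm i) * d q * (d (bm j) * d (am j)) =
      d (bm j) * d (am j) * (c (bm i) * d q) - if j = i then d q * d (am i) else 0 := by
    intro j
    ext1 v
    obtain rfl | hj := eq_or_ne j i
    · simp [h.dc, h.dd q (am j), h.dd q (bm j)]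
    · simp [h.dc, h.dd q (am j), h.dd q (bm j), hj]
  simp only [pairDown, Finset.mul_sum, Finset.sum_mul, key, Finset.sum_sub_distrib]
  simp

lemma CAR.commute_pairUp_Fm (h : CAR c d) : Commute (c Fm) (pairUp c) := by
  refine Commute.sum_right _ _ _ fun i _ => LinearMap.ext fun v => ?_
  simp only [Module.End.mul_apply]
  rw [h.cc Fm, h.cc Fm]
  simp

lemma CAR.commute_pairUp_wm (h : CAR c d) : Commute (d wm) (pairUp c) := by
  refine Commute.sum_right _ _ _ fun i _ => LinearMap.ext fun v => ?_
  simp [h.dc]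

lemma CAR.commute_pairDown_Fm (h : CAR c d) : Commute (c Fm) (pairDown d) := by
  refine Commute.sum_right _ _ _ fun i _ => LinearMap.ext fun v => ?_
  simp [h.dc]

lemma CAR.commute_pairDown_wm (h : CAR c d) : Commute (d wm) (pairDown d) := by
  refine Commute.sum_right _ _ _ fun i _ => LinearMap.ext fun v => ?_
  simp only [Module.End.mul_apply]
  rw [h.dd wm, h.dd wm]
  simp

/-- The pair creation and annihilation operators commute with the symmetry generators, except for
those which involve the special modes. -/
lemma SymOp.cases_commute (h : CAR c d) {X : Module.End ℂ W} (hX : SymOp c d X) :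
    (Commute X (pairUp c) ∧ Commute X (pairDown d) ∧ Commute X (c Fm) ∧ Commute X (d wm)) ∨
    (∃ Y, X = Y * d wm ∧ d wm * Y * d wm = 0) ∨ ∃ Y, X = c Fm * Y ∧ c Fm * Y * c Fm = 0 := by
  have hc0 : ∀ p, c p * c p = 0 := fun p => LinearMap.ext fun v => h.cc_self p v
  have hd0 : ∀ p, d p * d p = 0 := fun p => LinearMap.ext fun v => h.dd_self p v
  have hF : ∀ p q : Mode P, q ≠ Fm → Commute (c p * d q) (c Fm) := by
    intro p q hq
    refine LinearMap.ext fun v => ?_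
    simp only [Module.End.mul_apply]
    rw [h.cc Fm, h.dc, if_neg hq]
    simp
  have hw : ∀ p q : Mode P, p ≠ wm → Commute (c p * d q) (d wm) := by
    intro p q hp
    refine LinearMap.ext fun v => ?_
    simp only [Module.End.mul_apply]
    rw [h.dd q, h.dc, if_neg hp.symm]
    simp
  cases hX with
  | ab i =>
    refine .inl ⟨?_, ?_, hF _ _ (by simp), hw _ _ (by simp)⟩
    · simp [Commute, SemiconjBy, h.pairUp_bm, hc0]
    · simp [Commute, SemiconjBy, h.pairDown_am, hd0]
  | ba i =>
    refine .inl ⟨?_, ?_, hF _ _ (by simp), hw _ _ (by simp)⟩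
    · simp [Commute, SemiconjBy, h.pairUp_am, hc0]
    · simp [Commute, SemiconjBy, h.pairDown_bm, hd0]
  | raise i j _ =>
    refine .inl ⟨?_, ?_, (hF _ _ (by simp)).add_left (hF _ _ (by simp)),
      (hw _ _ (by simp)).add_left (hw _ _ (by simp))⟩
    · simp only [Commute, SemiconjBy, add_mul, mul_add, h.pairUp_bm]
      rw [h.mul_cc (am j) (am i)]
      abel
    · simp only [Commute, SemiconjBy, add_mul, mul_add, h.pairDown_am]
      rw [h.mul_dd (bm j) (bm i)]
      abel
  | lower i j _ =>
    refine .inl ⟨?_, ?_, (hF _ _ (by simp)).add_left (hF _ _ (by simp)),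
      (hw _ _ (by simp)).add_left (hw _ _ (by simp))⟩
    · simp only [Commute, SemiconjBy, add_mul, mul_add, h.pairUp_am]
      rw [h.mul_cc (bm j) (bm i)]
      abel
    · simp only [Commute, SemiconjBy, add_mul, mul_add, h.pairDown_bm]
      rw [h.mul_dd (am j) (am i)]
      abel
  | move i j _ =>
    refine .inl ⟨?_, ?_, (hF _ _ (by simp)).sub_left (hF _ _ (by simp)),
      (hw _ _ (by simp)).sub_left (hw _ _ (by simp))⟩
    · simp only [Commute, SemiconjBy, sub_mul, mul_sub, h.pairUp_am, h.pairUp_bm]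
      abel
    · simp only [Commute, SemiconjBy, sub_mul, mul_sub, h.pairDown_am, h.pairDown_bm]
      abel
  | toPair i β =>
    exact .inr (.inl ⟨_, rfl, LinearMap.ext fun v => by simp [h.dc, h.dd_self]⟩)
  | fromPair i β =>
    exact .inr (.inr ⟨_, rfl, LinearMap.ext fun v => by simp [h.dc, h.cc_self]⟩)
  | special =>
    exact .inr (.inr ⟨_, rfl, LinearMap.ext fun v => by simp [h.dc, h.cc_self]⟩)

lemma SymOp.commute_centOps (h : CAR c d) {X : Module.End ℂ W} (hX : SymOp c d X)
    {A : Module.End ℂ W} (hA : A ∈ centOps c d) : Commute X A := by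
  have hF0 : c Fm * c Fm = 0 := LinearMap.ext fun v => h.cc_self Fm v
  have hw0 : d wm * d wm = 0 := LinearMap.ext fun v => h.dd_self wm v
  have hFw : c Fm * d wm = -(d wm * c Fm) := LinearMap.ext fun v => by simp [h.dc]
  induction hA using Submodule.span_induction with
  | zero => exact Commute.zero_right _
  | add x y _ _ hx hy => exact hx.add_right hy
  | smul t x _ hx => exact hx.smul_right t
  | mem A hA =>
    obtain rfl | ⟨i, _, j, _, rfl⟩ := hA
    · exact Commute.one_right _
    have hFA : Commute (c Fm) (pairUp c ^ i * pairDown d ^ j) :=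
      (h.commute_pairUp_Fm.pow_right i).mul_right (h.commute_pairDown_Fm.pow_right j)
    have hwA : Commute (d wm) (pairUp c ^ i * pairDown d ^ j) :=
      (h.commute_pairUp_wm.pow_right i).mul_right (h.commute_pairDown_wm.pow_right j)
    obtain ⟨h1, h2, h3, h4⟩ | ⟨Y, rfl, hY⟩ | ⟨Y, rfl, hY⟩ := hX.cases_commute h
    · exact (h3.mul_right h4).mul_right ((h1.pow_right i).mul_right (h2.pow_right j))
    all_goals generalize pairUp c ^ i * pairDown d ^ j = B at *
    · have e1 : Y * d wm * (c Fm * d wm * B) = 0 := by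
        rw [hFw, show Y * d wm * (-(d wm * c Fm) * B) = -(Y * (d wm * d wm) * (c Fm * B)) by
          noncomm_ring, hw0]
        simp
      have e2 : c Fm * d wm * B * (Y * d wm) = 0 := by
        rw [mul_assoc (c Fm), hwA.eq, show c Fm * (B * d wm) * (Y * d wm) =
          c Fm * B * (d wm * Y * d wm) by noncomm_ring, hY, mul_zero]
      rw [Commute, SemiconjBy, e1, e2]
    · have e1 : c Fm * Y * (c Fm * d wm * B) = 0 := by
        rw [show c Fm * Y * (c Fm * d wm * B) = (c Fm * Y * c Fm) * (d wm * B) by noncomm_ring, hY,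
          zero_mul]
      have e2 : c Fm * d wm * B * (c Fm * Y) = 0 := by
        rw [hFw, show -(d wm * c Fm) * B * (c Fm * Y) = -(d wm * c Fm * (B * c Fm) * Y) by
          noncomm_ring, ← hFA.eq, show d wm * c Fm * (c Fm * B) * Y =
          d wm * (c Fm * c Fm) * B * Y by noncomm_ring, hF0]
        simp
      rw [Commute, SemiconjBy, e1, e2]

end Ladder

section Core

variable {P J W : Type*} [DecidableEq P] [AddCommGroup W] [Module ℂ W] [Fintype P]
  {c d : Mode P → Module.End ℂ W} {num : Module.End ℂ W} {vac : W}
  [DecidableEq J] [Fintype J] {s : Mode P → Bool} {e : J → P} {v : Finset J → W}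

namespace PairFamily

lemma pairUp_apply (h : CAR c d) (hv : PairFamily c d s e v) (C : Finset J) :
    pairUp c (v C) = ∑ j ∈ Cᶜ, v (insert j C) := by
  have h1 : ∑ j, c (am (e j)) (c (bm (e j)) (v C)) = pairUp c (v C) := by
    rw [pairUp, LinearMap.sum_apply]
    refine Finset.sum_of_injOn e hv.inj.injOn (by simp) ?_ (fun _ _ => rfl)
    intro i _ hi
    have hi' : ∀ j, e j ≠ i := fun j hj => hi ⟨j, by simp, hj⟩
    have hs := hv.single i hi'
    have hm := mem_occ.1 (hv.mem C)
    rw [Module.End.mul_apply]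
    cases hb : s (bm i)
    · have ha : s (am i) = true := by simpa [hb] using hs
      rw [h.cc, (hm (am i)).1 (by rw [filled_of_ne _ _ hi', ha])]
      simp
    · rw [(hm (bm i)).1 (by rw [filled_of_ne _ _ hi', hb]), map_zero]
  rw [← h1]
  refine (Finset.sum_subset (Finset.subset_univ _) fun j _ hj => ?_).symm.trans
    (Finset.sum_congr rfl fun j hj => hv.raise _ _ (by simpa using hj))
  rw [hv.c_eq_zero (by simpa using hj), map_zero]

lemma pairDown_apply (h : CAR c d) (hv : PairFamily c d s e v) (C : Finset J) :
    pairDown d (v C) = ∑ j ∈ C, v (C.erase j) := by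
  have h1 : ∑ j, d (bm (e j)) (d (am (e j)) (v C)) = pairDown d (v C) := by
    rw [pairDown, LinearMap.sum_apply]
    refine Finset.sum_of_injOn e hv.inj.injOn (by simp) ?_ (fun _ _ => rfl)
    intro i _ hi
    have hi' : ∀ j, e j ≠ i := fun j hj => hi ⟨j, by simp, hj⟩
    have hs := hv.single i hi'
    have hm := mem_occ.1 (hv.mem C)
    rw [Module.End.mul_apply]
    cases ha : s (am i)
    · rw [(hm (am i)).2 (by rw [filled_of_ne _ _ hi', ha]), map_zero]
    · have hb : s (bm i) = false := by simpa [ha] using hs.symm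
      rw [h.dd, (hm (bm i)).2 (by rw [filled_of_ne _ _ hi', hb])]
      simp
  rw [← h1]
  refine (Finset.sum_subset (Finset.subset_univ _) fun j _ hj => ?_).symm.trans
    (Finset.sum_congr rfl fun j hj => hv.lower h hj)
  rw [hv.d_eq_zero (by simpa using hj), map_zero]

/-- The coefficients in `PairFamily.exists_expansion` are unique. -/
lemma expansion_unique (h : CAR c d) (hv : PairFamily c d s e v) {C : Finset J} {τ τ' : ℂ}
    {g g' : Finset J → ℂ} (heq : τ • v C + ∑ C', g C' • c Fm (d wm (v C')) =
      τ' • v C + ∑ C', g' C' • c Fm (d wm (v C'))) : τ = τ' ∧ g = g' := by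
  let w : Option (Finset J) → W := fun o => o.elim (v C) fun C' => c Fm (d wm (v C'))
  let so : Option (Finset J) → Mode P → Bool := fun o => o.elim (filled s e C) fun C' =>
    Function.update (Function.update (filled s e C') wm false) Fm true
  have hso : Function.Injective so := by
    have hsF : ∀ C', so none ≠ so (some C') := fun C' hC' => by
      have := congrFun hC' Fm
      simp [so, filled_none, hv.occ_Fm] at this
    rintro (_ | x) (_ | y) hxy
    · rfl
    · exact absurd hxy (hsF y)
    · exact absurd hxy.symm (hsF x)
    · congr 1
      ext j
      have := congrFun hxy (am (e j))
      simpa [so, filled_some hv.inj hv.empty] using this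
  have hli : LinearIndependent ℂ w := by
    refine h.linearIndependent hso ?_ ?_
    · rintro (_ | x)
      · exact hv.mem C
      · exact h.c_mem_occ (h.d_mem_occ (hv.mem x) _) _
    · rintro (_ | x)
      · exact hv.ne C
      · intro h0
        obtain h1 | h1 := h.of_cd_eq_zero (hv.mem x) (hv.ne x) h0
        · simp [filled_none, hv.occ_wm] at h1
        · simp [filled_none, hv.occ_Fm] at h1
  have hz := (Fintype.linearIndependent_iff.1 hli) (fun o => o.elim (τ - τ') (g - g')) (by
    rw [Fintype.sum_option]
    simp only [Option.elim, w, Pi.sub_apply, sub_smul, Finset.sum_sub_distrib]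
    rw [sub_add_sub_comm, heq, sub_self])
  exact ⟨sub_eq_zero.1 (hz none), funext fun C' => sub_eq_zero.1 (hz (some C'))⟩

/-- On a family of vectors, an intertwiner is given by an element of the centralizer algebra. -/
lemma exists_centOps (h : FockRep c d num vac) (hv : PairFamily c d s e v)
    {T : Module.End ℂ W} (hT : ∀ X, SymOp c d X → ∀ u, T (X u) = X (T u)) {k k' : ℕ}
    (hpar : k % 2 = k' % 2) (hk' : ∀ u, num u = (k : ℂ) • u → num (T u) = (k' : ℂ) • T u)
    {m : ℕ} (hm : m ≤ Fintype.card J)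
    (hk : ∀ C : Finset J, C.card = m → num (v C) = (k : ℂ) • v C) :
    ∃ A ∈ centOps c d, ∀ C : Finset J, C.card = m → T (v C) = A (v C) := by
  have hcar := h.toCAR
  have hex : ∀ C : Finset J, ∃ (τ : ℂ) (g : Finset J → ℂ),
      (C.card = m → T (v C) = τ • v C + ∑ C', g C' • c Fm (d wm (v C'))) ∧
      (C.card ≠ m → τ = 0 ∧ g = 0) := by
    intro C
    by_cases hC : C.card = m
    · obtain ⟨τ, g, hg⟩ := hv.exists_expansion h hT hpar (hk C hC) (hk' _ (hk C hC))
      exact ⟨τ, g, fun _ => hg, fun hne => absurd hC hne⟩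
    · exact ⟨0, 0, fun hC' => absurd hC' hC, fun _ => ⟨rfl, rfl⟩⟩
  choose τ g hg hg0 using hex
  have hinv : ∀ i j, i ≠ j → ∀ B,
      τ (B.map (Equiv.swap i j).toEmbedding) = τ B ∧
      ∀ C, g (B.map (Equiv.swap i j).toEmbedding) (C.map (Equiv.swap i j).toEmbedding) = g B C := by
    intro i j hij B
    by_cases hB : B.card = m
    swap
    · have h1 := hg0 B hB
      have h2 := hg0 (B.map (Equiv.swap i j).toEmbedding) (by simpa using hB)
      simp [h1, h2]
    let σ := (Equiv.swap i j).toEmbedding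
    let X := c (bm (e i)) * d (am (e j)) + c (bm (e j)) * d (am (e i))
    let Y := c (am (e i)) * d (bm (e j)) + c (am (e j)) * d (bm (e i))
    have hne : e i ≠ e j := hv.inj.ne hij
    have hX : SymOp c d X := .lower _ _ hne
    have hY : SymOp c d Y := .raise _ _ hne
    have hS : ∀ C, v C - X (Y (v C)) = v (C.map σ) := hv.exchange hcar hij
    have hZ : c Fm * d wm ∈ centOps c d :=
      Submodule.subset_span (.inr ⟨0, by simp, 0, by simp, by simp⟩)
    have hSZ : ∀ C, c Fm (d wm (v C)) - X (Y (c Fm (d wm (v C)))) = c Fm (d wm (v (C.map σ))) := by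
      intro C
      have e1 := LinearMap.congr_fun (hX.commute_centOps hcar hZ).eq
      have e2 := LinearMap.congr_fun (hY.commute_centOps hcar hZ).eq
      simp only [Module.End.mul_apply] at e1 e2
      rw [e2, e1, ← hS, map_sub, map_sub]
    have hST : T (v (B.map σ)) = T (v B) - X (Y (T (v B))) := by
      rw [← hS, map_sub, hT _ hX, hT _ hY]
    rw [hg _ (by simpa using hB), hg B hB] at hST
    have hinvol : ∀ C : Finset J, (C.map σ).map σ = C := by
      intro C
      ext x
      simp [σ, Finset.mem_map_equiv]
    have hre : ∑ C', g B C' • c Fm (d wm (v (C'.map σ))) =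
        ∑ C', g B (C'.map σ) • c Fm (d wm (v C')) := by
      refine Finset.sum_bij' (fun C _ => C.map σ) (fun C _ => C.map σ) (by simp) (by simp)
        (by simp [hinvol]) (by simp [hinvol]) (by simp [hinvol])
    have hR : τ B • v B + ∑ C', g B C' • c Fm (d wm (v C')) -
        X (Y (τ B • v B + ∑ C', g B C' • c Fm (d wm (v C')))) =
        τ B • v (B.map σ) + ∑ C', g B (C'.map σ) • c Fm (d wm (v C')) := by
      rw [← hre, ← hS]
      simp only [← hSZ, map_add, map_smul, map_sum, smul_sub, Finset.sum_sub_distrib]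
      abel
    rw [hR] at hST
    obtain ⟨h1, h2⟩ := hv.expansion_unique hcar hST
    refine ⟨h1, fun C => ?_⟩
    rw [h2]
    exact congrArg (g B) (hinvol C)
  obtain ⟨A, hA, hgA⟩ := exists_raise_lower (hv.pairUp_apply hcar) (hv.pairDown_apply hcar) g
    (fun i j hij B C => (hinv i j hij B).2 C) hm
  obtain ⟨α, hα⟩ := exists_choose_expansion (fun B _ => τ B)
    (fun i j hij B _ => (hinv i j hij B).1) m
  have hcard : Fintype.card J ≤ Fintype.card P := Fintype.card_le_of_injective e hv.inj
  refine ⟨α 0 0 • 1 + c Fm * d wm * A, Submodule.add_mem _ (Submodule.smul_mem _ _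
    (Submodule.subset_span (.inl rfl))) ?_, fun C hC => ?_⟩
  · clear hgA
    induction hA using Submodule.span_induction with
    | mem x hx =>
      obtain ⟨i, hi, j, hj, rfl⟩ := hx
      exact Submodule.subset_span (.inr ⟨i, hi.trans hcard, j, hj.trans hcard, rfl⟩)
    | zero => rw [mul_zero]; exact Submodule.zero_mem _
    | add x y _ _ hx hy => rw [mul_add]; exact Submodule.add_mem _ hx hy
    | smul t x _ hx => rw [mul_smul_comm]; exact Submodule.smul_mem _ _ hx
  · have hτ : τ C = α 0 0 := by
      have := hα C ∅ hC
      rw [Finset.sum_range_succ'] at this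
      simpa using this
    rw [hg C hC, hτ]
    simp only [LinearMap.add_apply, LinearMap.smul_apply, Module.End.one_apply,
      Module.End.mul_apply]
    rw [← hgA C hC]
    simp only [map_sum, map_smul]

end PairFamily

end Core

section Core

variable {P J W : Type*} [DecidableEq P] [AddCommGroup W] [Module ℂ W] [Fintype P]
  {c d : Mode P → Module.End ℂ W} {num : Module.End ℂ W} {vac : W}
  [DecidableEq J] {s : Mode P → Bool} {e : J → P} {v : Finset J → W}

namespace PairFamily

lemma num_apply (h : FockRep c d num vac) (hv : PairFamily c d s e v) (C : Finset J) :
    num (v C) = ((count s + 2 * C.card : ℕ) : ℂ) • v C := by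
  induction C using Finset.induction_on with
  | empty =>
    have : filled s e ∅ = s := by funext p; simp [filled]
    have h1 := h.num_eq _ _ (hv.mem ∅)
    rw [this] at h1
    simpa using h1
  | insert j C hj ih =>
    rw [← hv.raise C j hj, h.num_c, h.num_c, ih, Finset.card_insert_of_notMem hj]
    push_cast
    simp only [map_add, map_smul, add_smul, mul_add, mul_one]
    rw [show (2 : ℂ) = 1 + 1 by norm_num, add_smul, one_smul]
    abel

/-- Vectors with the pair imbalances of the family belong to the family, up to a scalar. -/
lemma exists_smul [Fintype J] (h : FockRep c d num vac) (hv : PairFamily c d s e v)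
    {s' : Mode P → Bool}
    (hχ : ∀ i, ((s' (am i)).toNat : ℤ) - (s' (bm i)).toNat = (s (am i)).toNat - (s (bm i)).toNat)
    (hw : s' wm = true) (hF : s' Fm = false) {u : W} (hu : u ∈ occ c d s') (hu0 : u ≠ 0) {k : ℕ}
    (hk : num u = (k : ℂ) • u) :
    ∃ (C : Finset J) (t : ℂ), count s + 2 * C.card = k ∧ u = t • v C := by
  obtain ⟨C, hC⟩ := exists_filled hv.inj hv.empty hv.single hχ
  have hs' : s' = filled s e C := by
    funext ⟨p, β⟩
    cases p with
    | some i => rw [hC]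
    | none => cases β <;> simp [filled_none, hF, hw, hv.occ_Fm, hv.occ_wm]
  rw [hs'] at hu
  obtain ⟨t, ht⟩ := h.exists_smul _ _ (hv.mem C) _ hu (hv.ne C)
  refine ⟨C, t, ?_, ht⟩
  have hcount := h.count_eq (hv.mem C) (hv.ne C) (hv.num_apply h C)
  rw [← hcount, h.count_eq hu hu0 hk]

end PairFamily

/-- A vector whose only singly occupied pair is `i` is related to one whose only singly occupied
pair is `i₀`. -/
lemma FockRep.mem_of_sing_eq (h : FockRep c d num vac) (S : Submodule ℂ W)
    (hS : ∀ X, SymOp c d X → ∀ v ∈ S, X v ∈ S) (i₀ : P) {k : ℂ}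
    (hbase : ∀ s v, s wm = true → s Fm = false → sing s = {i₀} → s (am i₀) = true →
      s (bm i₀) = false → v ∈ occ c d s → num v = k • v → v ∈ S) {s : Mode P → Bool} {v : W} {i : P}
    (hw : s wm = true) (hF : s Fm = false) (hs : sing s = {i})
    (hv : v ∈ occ c d s) (hk : num v = k • v) : v ∈ S := by
  obtain ⟨s₁, v₁, ha₁, hb₁, hp₁, hsing₁, hv₁, hk₁, hS₁⟩ :=
    h.exists_flip S hS (show i ∈ sing s by simp [hs]) hv hk
  refine hS₁ ?_
  rw [hs] at hsing₁
  rw [← hp₁ wm (by simp)] at hw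
  rw [← hp₁ Fm (by simp)] at hF
  obtain rfl | hi := eq_or_ne i i₀
  · exact hbase s₁ v₁ hw hF hsing₁ ha₁ hb₁ hv₁ hk₁
  have hi₀ : s₁ (am i₀) = s₁ (bm i₀) := by
    have : i₀ ∉ sing s₁ := by simp [hsing₁, hi.symm]
    simpa [sing] using this
  have hm := mem_occ.1 hv₁
  have hsub : ∀ s₂ : Mode P → Bool, s₂ (am i₀) = true → s₂ (bm i₀) = false →
      s₂ (am i) = s₂ (bm i) → (∀ j β, j ≠ i → j ≠ i₀ → s₂ (some j, β) = s₁ (some j, β)) →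
      sing s₂ = {i₀} := by
    intro s₂ h1 h2 h3 h4
    ext j
    have hj : s₁ (am j) ≠ s₁ (bm j) ↔ j = i := by
      rw [← Finset.mem_singleton, ← hsing₁]; simp [sing]
    simp only [sing, Finset.mem_filter, Finset.mem_univ, true_and, Finset.mem_singleton]
    obtain rfl | hj1 := eq_or_ne j i₀
    · simp [h1, h2]
    obtain rfl | hj2 := eq_or_ne j i
    · simp [h3, hj1]
    · simp [h4 j _ hj2 hj1, hj1, hj2, not_iff_not.2 hj]
  cases hb : s₁ (bm i₀)
  · rw [hb] at hi₀
    have hz : v₁ = (c (am i) * d (am i₀) - c (bm i₀) * d (bm i)) (c (am i₀) (d (am i) v₁)) := by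
      have e1 := h.cd_of_c_eq_zero ((hm (am i)).1 ha₁)
      have e2 := (hm (am i₀)).2 hi₀
      have e3 := (hm (bm i)).2 hb₁
      have e4 := h.dd (am i₀) (am i) v₁
      have e5 := h.dd (bm i) (am i) v₁
      rw [e2, map_zero, neg_zero] at e4
      rw [e3, map_zero, neg_zero] at e5
      simp [h.dc, e1, e4, e5]
    rw [hz]
    refine hS _ (.move i i₀ hi) _ (hbase _ _ ?_ ?_ (hsub _ ?_ ?_ ?_ ?_) ?_ ?_
      (h.c_mem_occ (h.d_mem_occ hv₁ (am i)) (am i₀)) (h.num_cd hk₁ _ _))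
    all_goals simp +contextual [hw, hF, hi, hi.symm, hb, hb₁]
  · rw [hb] at hi₀
    have hz : v₁ = (c (am i) * d (am i₀) - c (bm i₀) * d (bm i)) (-c (bm i) (d (bm i₀) v₁)) := by
      have e1 := h.cd_of_c_eq_zero ((hm (bm i₀)).1 hb)
      have e2 := (hm (bm i)).2 hb₁
      have e3 := (hm (am i)).1 ha₁
      have e4 := h.dd (bm i) (bm i₀) v₁
      rw [e2, map_zero, neg_zero] at e4
      have e5 : c (am i) (d (am i₀) (c (bm i) (d (bm i₀) v₁))) = 0 := by
        rw [h.bilinear, h.c_d_eq_zero (by simp [hi.symm]) e3]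
        simp
      simp [h.dc, e1, e4]
      simpa [h.dc, e4] using e5
    rw [hz]
    refine hS _ (.move i i₀ hi) _ (S.neg_mem (hbase _ _ ?_ ?_ (hsub _ ?_ ?_ ?_ ?_) ?_ ?_
      (h.c_mem_occ (h.d_mem_occ hv₁ (bm i₀)) (bm i)) (h.num_cd hk₁ _ _)))
    all_goals simp +contextual [hw, hF, hi, hi.symm, hi₀, ha₁]

/-- Intertwiners on the sectors other than the first and the last. -/
theorem FockRep.exists_centOps (h : FockRep c d num vac) {T : Module.End ℂ W}
    (hT : ∀ X, SymOp c d X → ∀ u, T (X u) = X (T u)) {k k' : ℕ} (hk0 : 1 ≤ k)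
    (hk1 : k ≤ 2 * Fintype.card P + 1) (hpar : k % 2 = k' % 2)
    (hk' : ∀ u, num u = (k : ℂ) • u → num (T u) = (k' : ℂ) • T u) :
    ∃ A ∈ centOps c d, ∀ u, num u = (k : ℂ) • u → T u = A u := by
  have hstable : ∀ A ∈ centOps c d, ∀ X, SymOp c d X → ∀ v ∈ LinearMap.ker (T - A),
      X v ∈ LinearMap.ker (T - A) := by
    intro A hA X hX v hv
    rw [LinearMap.mem_ker, LinearMap.sub_apply, sub_eq_zero] at hv ⊢
    have := LinearMap.congr_fun (hX.commute_centOps h.toCAR hA).eq v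
    simp only [Module.End.mul_apply] at this
    rw [hT X hX, ← this, hv]
  suffices H : ∃ A ∈ centOps c d, ∀ s v, s wm = true → s Fm = false → (sing s).card ≤ 1 →
      v ∈ occ c d s → num v = (k : ℂ) • v → v ∈ LinearMap.ker (T - A) by
    obtain ⟨A, hA, hbase⟩ := H
    refine ⟨A, hA, fun u hu => ?_⟩
    have := h.mem_of_mem_sector (LinearMap.ker (T - A)) (hstable A hA) k hk0 hk1
      (h.mem_of_wm _ (hstable A hA) k hbase) u hu
    rwa [LinearMap.mem_ker, LinearMap.sub_apply, sub_eq_zero] at this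
  have hparity : ∀ s v, s wm = true → s Fm = false → v ∈ occ c d s → v ≠ 0 →
      num v = (k : ℂ) • v → k % 2 = (1 + (sing s).card) % 2 := by
    intro s v hw hF hv hv0 hk
    have := count_parity s
    rwa [h.count_eq hv hv0 hk, hw, hF] at this
  obtain hodd | heven : k % 2 = 1 ∨ k % 2 = 0 := by omega
  · let s₀ : Mode P → Bool := fun p => decide (p = wm)
    have hs₀ : count s₀ = 1 := by
      have : Finset.univ.filter (fun p => s₀ p = true) = {wm} := by
        ext p; simp [s₀]
      rw [count, this, Finset.card_singleton]
    obtain ⟨v₀, hv₀, hne⟩ := h.exists_ne_zero s₀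
    obtain ⟨v, hv⟩ := h.toCAR.exists_pairFamily (e := (id : P → P)) Function.injective_id
      (by simp [s₀]) (by simp [s₀]) (by simp [s₀]) (fun i hi => absurd rfl (hi i)) hv₀ hne
    obtain ⟨A, hA, hTA⟩ := hv.exists_centOps h hT hpar hk' (m := (k - 1) / 2) (by omega)
      (fun C hC => by rw [hv.num_apply h, hs₀, hC]; congr 2; omega)
    refine ⟨A, hA, fun s u hw hF hs hu hk => ?_⟩
    obtain rfl | hu0 := eq_or_ne u 0
    · exact Submodule.zero_mem _
    have hp := hparity s u hw hF hu hu0 hk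
    have hsing : sing s = ∅ := Finset.card_eq_zero.1 (by omega)
    obtain ⟨C, t, hC, rfl⟩ := hv.exists_smul h (fun i => by
      have : i ∉ sing s := by simp [hsing]
      have : s (am i) = s (bm i) := by simpa [sing] using this
      simp [this, s₀]) hw hF hu hu0 hk
    rw [LinearMap.mem_ker, LinearMap.sub_apply, sub_eq_zero, map_smul, map_smul,
      hTA C (by omega)]
  · obtain ⟨i₀⟩ : Nonempty P := Fintype.card_pos_iff.1 (by omega)
    let s₀ : Mode P → Bool := fun p => decide (p = wm ∨ p = am i₀)
    have hs₀ : count s₀ = 2 := by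
      have : Finset.univ.filter (fun p => s₀ p = true) = {wm, am i₀} := by
        ext p; simp [s₀]
      rw [count, this, Finset.card_pair (by simp)]
    obtain ⟨v₀, hv₀, hne⟩ := h.exists_ne_zero s₀
    obtain ⟨v, hv⟩ := h.toCAR.exists_pairFamily (e := (Subtype.val : {i // i ≠ i₀} → P))
      Subtype.val_injective (by simp [s₀]) (by simp [s₀]) (fun j β => by simp [s₀, j.2])
      (fun i hi => by
        obtain rfl : i = i₀ := by
          by_contra hne
          exact hi ⟨i, hne⟩ rfl
        simp [s₀]) hv₀ hne
    have hcard : Fintype.card {i // i ≠ i₀} = Fintype.card P - 1 := by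
      simp [Fintype.card_subtype_compl]
    obtain ⟨A, hA, hTA⟩ := hv.exists_centOps h hT hpar hk' (m := (k - 2) / 2) (by omega)
      (fun C hC => by rw [hv.num_apply h, hs₀, hC]; congr 2; omega)
    refine ⟨A, hA, fun s u hw hF hs hu hk => ?_⟩
    obtain rfl | hu0 := eq_or_ne u 0
    · exact Submodule.zero_mem _
    have hp := hparity s u hw hF hu hu0 hk
    obtain ⟨i, hi⟩ := Finset.card_eq_one.1 (show (sing s).card = 1 by omega)
    refine h.mem_of_sing_eq _ (hstable A hA) i₀ ?_ hw hF hi hu hk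
    intro s u hw hF hs ha hb hu hk
    obtain rfl | hu0 := eq_or_ne u 0
    · exact Submodule.zero_mem _
    obtain ⟨C, t, hC, rfl⟩ := hv.exists_smul h (fun i => by
      obtain rfl | hi := eq_or_ne i i₀
      · simp [ha, hb, s₀]
      · have : i ∉ sing s := by simp [hs, hi]
        have : s (am i) = s (bm i) := by simpa [sing] using this
        simp [this, s₀, hi]) hw hF hu hu0 hk
    rw [LinearMap.mem_ker, LinearMap.sub_apply, sub_eq_zero, map_smul, map_smul,
      hTA C (by omega)]

end Core

section Extremal

variable {P W : Type*} [DecidableEq P] [AddCommGroup W] [Module ℂ W]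
  {c d : Mode P → Module.End ℂ W} {num : Module.End ℂ W} {vac : W}

lemma SymOp.apply_eq_zero (h : CAR c d) {X : Module.End ℂ W} (hX : SymOp c d X) {u : W}
    (hu : (∀ p, c p u = 0) ∨ ∀ p, d p u = 0) : X u = 0 := by
  have key : ∀ p q, q ≠ p → c p (d q u) = 0 := by
    intro p q hpq
    obtain hu | hu := hu
    · exact h.c_d_eq_zero hpq (hu p)
    · rw [hu, map_zero]
  cases hX with
  | ab i => exact key _ _ (by simp)
  | ba i => exact key _ _ (by simp)
  | raise i j hij => simp [key (am i) (bm j) (by simp), key (am j) (bm i) (by simp)]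
  | lower i j hij => simp [key (bm i) (am j) (by simp), key (bm j) (am i) (by simp)]
  | move i j hij =>
    simp [key (am i) (am j) (by simp [hij.symm]), key (bm j) (bm i) (by simp [hij])]
  | toPair i β => exact key _ _ (by simp)
  | fromPair i β => exact key _ _ (by simp)
  | special => exact key _ _ (by simp)

/-- Vectors annihilated by the symmetric operators live in the first and last even sectors. -/
lemma FockRep.eq_zero_of_symOp [Fintype P] (h : FockRep c d num vac) {u : W}
    (hX : ∀ X, SymOp c d X → X u = 0) {k : ℕ} (hk : num u = (k : ℂ) • u) (heven : k % 2 = 0)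
    (h0 : k ≠ 0) (hN : k ≠ 2 * Fintype.card P + 2) : u = 0 := by
  let Q : Submodule ℂ W := LinearMap.ker (num - (k : ℂ) • 1) ⊓
    ⨅ x : {x : Mode P × Mode P // SymOp c d (c x.1 * d x.2)}, LinearMap.ker (c x.1.1 * d x.1.2)
  have hQ : ∀ v, v ∈ Q ↔ num v = (k : ℂ) • v ∧
      ∀ p q, SymOp c d (c p * d q) → c p (d q v) = 0 := by
    intro v
    simp [Q, sub_eq_zero]
  suffices Q ≤ ⊥ by
    simpa using this ((hQ u).2 ⟨hk, fun p q hpq => hX _ hpq⟩)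
  refine h.le_of_occ_le Q ⊥ (fun p v hv => ?_) fun s v hv hs => ?_
  · rw [hQ] at hv ⊢
    refine ⟨h.num_cd hv.1 p p, fun q r hqr => ?_⟩
    rw [h.bilinear_num, hv.2 q r hqr]
    simp
  · rw [hQ] at hv
    rw [Submodule.mem_bot]
    by_contra hv0
    have key : ∀ p q, SymOp c d (c p * d q) → s q = false ∨ s p = true := fun p q hpq =>
      h.of_cd_eq_zero hs hv0 (hv.2 p q hpq)
    have hcount := h.count_eq hs hv0 hv.1
    have hpairs := count_pairs s
    have hpar := count_parity s
    have hsing : sing s = ∅ := by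
      ext i
      have h1 := key _ _ (.ab i)
      have h2 := key _ _ (.ba i)
      cases ha : s (am i) <;> cases hb : s (bm i) <;> simp_all [sing]
    have hto := fun i β => key _ _ (.toPair i β)
    have hfrom := fun i β => key _ _ (.fromPair i β)
    have hsp := key _ _ .special
    rw [hsing] at hpar
    cases hw : s wm <;> cases hF : s Fm <;> simp [hw, hF] at hto hfrom hsp hpar hpairs
    · simp [hfrom] at hpairs
      omega
    · omega
    · simp [hto] at hpairs
      omega

end Extremal

section Lie

variable {ι W : Type*} [DecidableEq ι] [AddCommGroup W] [Module ℂ W]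
  {c d : ι → Module.End ℂ W}

/-- The commutator as a bilinear map. -/
def comm : Module.End ℂ W →ₗ[ℂ] Module.End ℂ W →ₗ[ℂ] Module.End ℂ W :=
  LinearMap.mul ℂ _ - (LinearMap.mul ℂ _).flip

lemma comm_apply (X Y : Module.End ℂ W) : comm X Y = X * Y - Y * X := rfl

lemma CAR.comm_bilinear (h : CAR c d) (p q r s : ι) :
    comm (c p * d q) (c r * d s) =
      (if q = r then c p * d s else 0) - (if s = p then c r * d q else 0) := by
  ext v
  simp only [comm_apply, LinearMap.sub_apply, Module.End.mul_apply]
  rw [h.bilinear]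
  split_ifs <;> (simp; try abel)

lemma comm_mem {S : Subalgebra ℂ (Module.End ℂ W)} {X Y : Module.End ℂ W}
    (hX : X ∈ S) (hY : Y ∈ S) : comm X Y ∈ S := by
  rw [comm_apply]
  exact S.sub_mem (S.mul_mem hX hY) (S.mul_mem hY hX)

lemma CAR.mem_of_step (h : CAR c d) {S : Subalgebra ℂ (Module.End ℂ W)} {a b x y : ι}
    (hab : a ≠ b) (hax : a ≠ x) (hay : a ≠ y) (hbx : b ≠ x) (hby : b ≠ y)
    (h1 : c a * d b ∈ S) (h2 : c b * d a ∈ S) (h3 : (c x - c a) * (d y - d b) ∈ S) :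
    c x * d y ∈ S ∧ c a * d y + c x * d b ∈ S := by
  have hK : c a * d y + c x * d b ∈ S := by
    have h4 := S.sub_mem (S.smul_mem h1 2) (comm_mem h1 (comm_mem h2 h3))
    convert h4 using 1
    simp only [mul_sub, sub_mul, map_sub, h.comm_bilinear, hab.symm, hax, hay.symm, hbx, hby.symm,
      if_true, if_false, sub_zero, zero_sub, map_neg]
    module
  refine ⟨?_, hK⟩
  convert S.add_mem (S.sub_mem h3 h1) hK using 1
  noncomm_ring

end Lie

section Generation

variable {W : Type*} [AddCommGroup W] [Module ℂ W] {n : ℕ}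
  {c d : Mode (Fin n) → Module.End ℂ W}

/-- The modes `am i` followed by `Fm`. -/
def aMode (n i : ℕ) : Mode (Fin n) := if h : i < n then am ⟨i, h⟩ else Fm

/-- The modes `bm i` followed by `wm`. -/
def bMode (n i : ℕ) : Mode (Fin n) := if h : i < n then bm ⟨i, h⟩ else wm

lemma aMode_of_lt {i : ℕ} (h : i < n) : aMode n i = am ⟨i, h⟩ := dif_pos h

lemma bMode_of_lt {i : ℕ} (h : i < n) : bMode n i = bm ⟨i, h⟩ := dif_pos h

lemma aMode_self : aMode n n = Fm := dif_neg (lt_irrefl n)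

lemma bMode_self : bMode n n = wm := dif_neg (lt_irrefl n)

/-- The periodic Temperley–Lieb generators generate the symmetric operators. -/
theorem SymOp.mem_of_generators (h : CAR c d) {S : Subalgebra ℂ (Module.End ℂ W)}
    (hzero : c (aMode n 0) * d (bMode n 0) ∈ S)
    (hsucc : ∀ i < n, (c (aMode n (i + 1)) - c (aMode n i)) *
      (d (bMode n (i + 1)) - d (bMode n i)) ∈ S)
    (hodd : ∀ i, c (bm i) * d (am i) ∈ S)
    (hlast : (c Fm - ∑ i, c (bm i)) * (d wm - ∑ i, d (am i)) ∈ S)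
    {X : Module.End ℂ W} (hX : SymOp c d X) : X ∈ S := by
  have hstep : ∀ i < n, c (aMode n i) * d (bMode n i) ∈ S →
      c (aMode n (i + 1)) * d (bMode n (i + 1)) ∈ S ∧ c (aMode n i) * d (bMode n (i + 1)) +
        c (aMode n (i + 1)) * d (bMode n i) ∈ S := by
    intro i hi hD
    have h3 := hsucc i hi
    rw [aMode_of_lt hi, bMode_of_lt hi] at hD h3 ⊢
    refine h.mem_of_step ?_ ?_ ?_ ?_ ?_ hD (hodd _) h3 <;> grind [aMode, bMode]
  have hD' : ∀ i ≤ n, c (aMode n i) * d (bMode n i) ∈ S := by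
    intro i
    induction i with
    | zero => exact fun _ => hzero
    | succ i ih => exact fun hi => (hstep i hi (ih (by omega))).1
  have hD : ∀ i, c (am i) * d (bm i) ∈ S := by
    intro i
    have := hD' i i.2.le
    rwa [aMode_of_lt i.2, bMode_of_lt i.2] at this
  have hK : ∀ i j, i ≠ j → c (am i) * d (bm j) + c (am j) * d (bm i) ∈ S := by
    intro i j hij
    convert S.neg_mem (comm_mem (hD j) (comm_mem (hD i) hlast)) using 1
    simp [mul_sub, sub_mul, Finset.sum_mul, Finset.mul_sum, map_sub, map_sum, h.comm_bilinear,
      hij, hij.symm, add_comm]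
  have hmove : ∀ i j, i ≠ j → c (am i) * d (am j) - c (bm j) * d (bm i) ∈ S := by
    intro i j hij
    convert S.neg_mem (comm_mem (hodd j) (hK i j hij)) using 1
    simp [h.comm_bilinear, hij, hij.symm]
    abel
  have hdiff : ∀ i, c Fm * d (bm i) - c (am i) * d wm ∈ S := by
    intro i
    have hm : ∀ j, c (am i) * d (am j) - c (bm j) * d (bm i) ∈ S := by
      intro j
      obtain rfl | hij := eq_or_ne i j
      · convert comm_mem (hD i) (hodd i) using 1
        simp [h.comm_bilinear]
      · exact hmove i j hij
    convert S.sub_mem (comm_mem (hD i) hlast)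
      (S.sum_mem (t := Finset.univ) fun j _ => hm j) using 1
    simp [mul_sub, sub_mul, Finset.sum_mul, Finset.mul_sum, map_sub, map_sum, h.comm_bilinear,
      Finset.sum_sub_distrib]
    abel
  have hto : ∀ i, c (am i) * d wm ∈ S := by
    intro i
    obtain ⟨m, rfl⟩ : ∃ m, n = m + 1 := ⟨n - 1, by have := i.2; omega⟩
    have hl : c (am (Fin.last m)) * d wm ∈ S := by
      have h1 := (hstep m (by omega) (hD' m (by omega))).2
      rw [aMode_of_lt m.lt_succ_self, bMode_of_lt m.lt_succ_self, aMode_self, bMode_self] at h1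
      convert S.smul_mem (S.sub_mem h1 (hdiff (Fin.last m))) (1 / 2 : ℂ) using 1
      rw [show (⟨m, by omega⟩ : Fin (m + 1)) = Fin.last m from rfl]
      module
    obtain rfl | hi := eq_or_ne i (Fin.last m)
    · exact hl
    · convert comm_mem (hmove i _ hi) hl using 1
      simp [h.comm_bilinear]
  have hfrom : ∀ i, c Fm * d (bm i) ∈ S := by
    intro i
    simpa using S.add_mem (hdiff i) (hto i)
  cases hX with
  | ab i => exact hD i
  | ba i => exact hodd i
  | raise i j hij => exact hK i j hij
  | lower i j hij =>
    convert comm_mem (hodd i) (hmove i j hij) using 1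
    simp [h.comm_bilinear, hij, hij.symm]
  | move i j hij => exact hmove i j hij
  | toPair i β =>
    cases β
    · exact hto i
    · convert comm_mem (hodd i) (hto i) using 1
      simp [h.comm_bilinear]
  | fromPair i β =>
    cases β
    · convert S.neg_mem (comm_mem (hodd i) (hfrom i)) using 1
      simp [h.comm_bilinear]
    · exact hfrom i
  | special =>
    have := hD' n le_rfl
    rwa [aMode_self, bMode_self] at this

end Generation

section JordanWigner

variable {N : ℕ}

lemma site_mulVec (a : Matrix (Fin 2) (Fin 2) ℂ) (j : Fin N) (v : V N) (x : Fin N → Fin 2) :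
    (site N a j).mulVec v x = ∑ b, a (x j) b * v (Function.update x j b) := by
  simp only [Matrix.mulVec, dotProduct, site, Matrix.of_apply]
  symm
  refine Finset.sum_of_injOn (fun b => Function.update x j b)
    (fun b _ b' _ h => by simpa using congrFun h j) (by simp) ?_ ?_
  · intro y _ hy
    have : ∃ k, k ≠ j ∧ x k ≠ y k := by
      by_contra! hcon
      refine hy ⟨y j, by simp, ?_⟩
      funext k
      obtain rfl | hk := eq_or_ne k j
      · simp
      · simp [hk, hcon k hk]
    obtain ⟨k, hk, hxy⟩ := this
    rw [Finset.prod_eq_zero (i := k) (by simp [hk]) (by simp [hxy])]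
    simp
  · intro b _
    rw [Finset.prod_eq_one]
    · simp
    · intro k hk
      simp only [Finset.mem_filter] at hk
      simp [hk.2]

lemma site_diagonal_mulVec (z : Fin 2 → ℂ) (j : Fin N) (v : V N) (x : Fin N → Fin 2) :
    (site N (Matrix.diagonal z) j).mulVec v x = z (x j) * v x := by
  rw [site_mulVec, Finset.sum_eq_single (x j)]
  · simp
  · intro b _ hb
    simp [Matrix.diagonal_apply_ne _ hb.symm]
  · simp

lemma string_mulVec (z : Fin 2 → ℂ) (j : Fin N) (v : V N) (x : Fin N → Fin 2) :
    (string N z j).mulVec v x = (∏ k ∈ Finset.Iio j, z (x k)) * v x := by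
  have H : ∀ l : List (Fin N), ((l.map fun k => site N (Matrix.diagonal z) k).prod).mulVec v x
      = (l.map fun k => z (x k)).prod * v x := by
    intro l
    induction l with
    | nil => simp
    | cons k l ih =>
      rw [List.map_cons, List.prod_cons, ← Matrix.mulVec_mulVec, site_diagonal_mulVec, ih]
      simp [mul_assoc]
  rw [string, H, ← List.prod_toFinset _ ((List.nodup_finRange N).filter _)]
  congr 2
  ext k
  simp

/-- The Jordan–Wigner sign. -/
def jwSign (j : Fin N) (x : Fin N → Fin 2) : ℂ := ∏ k ∈ Finset.Iio j, (-1) ^ (x k : ℕ)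

/-- The operator flipping the spin at site `j` to the value `b`, with the Jordan–Wigner sign. -/
def jw (j : Fin N) (b : Fin 2) : Module.End ℂ (V N) where
  toFun v x := if x j = b then jwSign j x * v (Function.update x j (1 - b)) else 0
  map_add' u v := by
    funext x
    simp only [Pi.add_apply]
    split_ifs <;> ring
  map_smul' t v := by
    funext x
    simp only [Pi.smul_apply, smul_eq_mul, RingHom.id_apply]
    split_ifs <;> ring

lemma jw_apply (j : Fin N) (b : Fin 2) (v : V N) (x : Fin N → Fin 2) :
    jw j b v x = if x j = b then jwSign j x * v (Function.update x j (1 - b)) else 0 := rfl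

lemma jwSign_update_of_le {i j : Fin N} (h : j ≤ i) (x : Fin N → Fin 2) (b : Fin 2) :
    jwSign j (Function.update x i b) = jwSign j x := by
  refine Finset.prod_congr rfl fun k hk => ?_
  rw [Function.update_of_ne (ne_of_lt ((Finset.mem_Iio.1 hk).trans_le h))]

lemma jwSign_update_of_lt {i j : Fin N} (h : i < j) (x : Fin N → Fin 2) :
    jwSign j (Function.update x i (1 - x i)) = -jwSign j x := by
  rw [jwSign, jwSign, ← Finset.mul_prod_erase _ _ (Finset.mem_Iio.2 h),
    ← Finset.mul_prod_erase _ _ (Finset.mem_Iio.2 h), ← neg_mul]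
  congr 1
  · have : ∀ b : Fin 2, (-1 : ℂ) ^ ((1 - b : Fin 2) : ℕ) = -(-1) ^ (b : ℕ) := by
      intro b; fin_cases b <;> simp
    simp [this]
  · refine Finset.prod_congr rfl fun k hk => ?_
    rw [Function.update_of_ne (Finset.ne_of_mem_erase hk)]

lemma jwSign_mul_self (j : Fin N) (x : Fin N → Fin 2) : jwSign j x * jwSign j x = 1 := by
  rw [jwSign, ← Finset.prod_mul_distrib]
  exact Finset.prod_eq_one fun k _ => by rw [← mul_pow]; simp

lemma jw_anticomm_of_lt {i j : Fin N} (h : i < j) (b b' : Fin 2) (v : V N) :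
    jw i b (jw j b' v) = -jw j b' (jw i b v) := by
  funext x
  simp only [jw_apply, Pi.neg_apply, Function.update_of_ne h.ne, Function.update_of_ne h.ne']
  by_cases hi : x i = b
  · subst hi
    rw [jwSign_update_of_lt h, jwSign_update_of_le h.le, Function.update_comm h.ne]
    split_ifs <;> simp
    ring
  · simp [hi]

lemma jw_anticomm_of_ne {i j : Fin N} (h : i ≠ j) (b b' : Fin 2) (v : V N) :
    jw i b (jw j b' v) = -jw j b' (jw i b v) := by
  obtain h | h := h.lt_or_gt
  · exact jw_anticomm_of_lt h b b' v
  · rw [jw_anticomm_of_lt h, neg_neg]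

lemma jw_jw_self (j : Fin N) (b : Fin 2) (v : V N) : jw j b (jw j b v) = 0 := by
  funext x
  have : 1 - b ≠ b := by fin_cases b <;> simp
  simp [jw_apply, this]

lemma jw_zero_one (j : Fin N) (v : V N) : jw j 0 (jw j 1 v) = v - jw j 1 (jw j 0 v) := by
  funext x
  have hb : x j = 0 ∨ x j = 1 := by
    generalize x j = b
    fin_cases b <;> simp
  have hs : ∀ b, jwSign j x * (jwSign j (Function.update x j b) * v x) = v x := by
    intro b
    rw [jwSign_update_of_le le_rfl, ← mul_assoc, jwSign_mul_self, one_mul]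
  obtain hb | hb := hb
  · have hu : Function.update x j 0 = x := by rw [← hb, Function.update_eq_self]
    simp [jw_apply, hb, hu, hs]
  · have hu : Function.update x j 1 = x := by rw [← hb, Function.update_eq_self]
    simp [jw_apply, hb, hu, hs]

/-- The phase relating the `gl(1|1)` fermions to the Jordan–Wigner operators. -/
def phase (j : ℕ) : ℂ := I * (-I) ^ j

lemma phase_ne_zero (j : ℕ) : phase j ≠ 0 := by simp [phase]

lemma phase_mul_self (j : ℕ) : phase j * phase j = (-1) ^ (j + 1) := by
  rw [phase, mul_mul_mul_comm, ← mul_pow]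
  simp [pow_succ]

lemma prod_Iio_signs (a : ℂ) (z : Fin 2 → ℂ) (hz : ∀ b, z b = a * (-1) ^ (b : ℕ)) (j : Fin N)
    (x : Fin N → Fin 2) : ∏ k ∈ Finset.Iio j, z (x k) = a ^ (j : ℕ) * jwSign j x := by
  simp [hz, Finset.prod_mul_distrib, jwSign]

lemma toLin_f (j : Fin N) : Matrix.toLinAlgEquiv' (f N j) = phase j • jw j 1 := by
  refine LinearMap.ext fun v => funext fun x => ?_
  have hb : x j = 0 ∨ x j = 1 := by
    generalize x j = b
    fin_cases b <;> simp
  have hI : I ^ ((j : ℕ) + 1) * I ^ (-(j : ℤ)) = I := by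
    rw [pow_succ, _root_.zpow_neg, zpow_natCast]
    field_simp
  simp only [f, c, map_smul, LinearMap.smul_apply, Pi.smul_apply, Matrix.toLinAlgEquiv'_apply,
    ← Matrix.mulVec_mulVec, string_mulVec, site_mulVec, jw_apply, smul_eq_mul, Fin.sum_univ_two]
  rw [prod_Iio_signs (-I) _ (by intro b; fin_cases b <;> simp), ← mul_assoc, hI, phase]
  obtain hb | hb := hb <;> (simp [hb, sigmaMinus, sigmaX, sigmaY]; try ring)

lemma toLin_fd (j : Fin N) : Matrix.toLinAlgEquiv' (fd N j) = phase j • jw j 0 := by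
  refine LinearMap.ext fun v => funext fun x => ?_
  have hb : x j = 0 ∨ x j = 1 := by
    generalize x j = b
    fin_cases b <;> simp
  have hI : I ^ ((j : ℕ) + 1) * I ^ (j : ℕ) * I ^ (j : ℕ) = I * (-I) ^ (j : ℕ) := by
    rw [pow_succ, mul_comm (I ^ (j : ℕ)) I, mul_assoc I, mul_assoc I, ← mul_pow, ← mul_pow]
    simp
  simp only [fd, cd, map_smul, LinearMap.smul_apply, Pi.smul_apply, Matrix.toLinAlgEquiv'_apply,
    ← Matrix.mulVec_mulVec, string_mulVec, site_mulVec, jw_apply, smul_eq_mul, Fin.sum_univ_two]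
  rw [prod_Iio_signs I _ (by intro b; fin_cases b <;> simp), phase, ← hI]
  obtain hb | hb := hb <;> (simp [hb, sigmaPlus, sigmaX, sigmaY]; try ring)

/-- The number of down spins. -/
def downs (x : Fin N → Fin 2) : ℕ := ∑ j, (x j : ℕ)

lemma downs_update {x : Fin N → Fin 2} {j : Fin N} (h : x j = 1) :
    downs x = downs (Function.update x j 0) + 1 := by
  rw [downs, downs, ← Finset.add_sum_erase _ _ (Finset.mem_univ j),
    ← Finset.add_sum_erase _ _ (Finset.mem_univ j), h]
  have : ∀ k ∈ Finset.univ.erase j, ((Function.update x j 0 k : Fin 2) : ℕ) = x k := by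
    intro k hk
    rw [Function.update_of_ne (Finset.ne_of_mem_erase hk)]
  rw [Finset.sum_congr rfl this]
  simp [add_comm]

lemma Sz_mulVec (v : V N) (x : Fin N → Fin 2) :
    (Sz N).mulVec v x = ((N : ℂ) / 2 - downs x) * v x := by
  have hz : sigmaZ = Matrix.diagonal ![1, -1] := by
    ext a b; fin_cases a <;> fin_cases b <;> simp [sigmaZ]
  have hb : ∀ b : Fin 2, (![1, -1] b : ℂ) = 1 - 2 * (b : ℕ) := by
    intro b; fin_cases b <;> norm_num
  rw [Sz, Matrix.smul_mulVec, Pi.smul_apply, Matrix.sum_mulVec, Finset.sum_apply, hz]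
  simp only [site_diagonal_mulVec, hb, ← Finset.sum_mul, Finset.sum_sub_distrib, ← Finset.mul_sum,
    downs]
  simp
  ring

end JordanWigner

section Modes

variable {W : Type*} [AddCommGroup W] [Module ℂ W]

/-- The anticommutator as a bilinear map. -/
def acomm : Module.End ℂ W →ₗ[ℂ] Module.End ℂ W →ₗ[ℂ] Module.End ℂ W :=
  LinearMap.mul ℂ _ + (LinearMap.mul ℂ _).flip

lemma acomm_apply (X Y : Module.End ℂ W) : acomm X Y = X * Y + Y * X := rfl

lemma acomm_eq_iff {X Y : Module.End ℂ W} {t : ℂ} :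
    acomm X Y = t • 1 ↔ ∀ v, X (Y v) = t • v - Y (X v) := by
  rw [acomm_apply, LinearMap.ext_iff]
  simp [eq_sub_iff_add_eq]

lemma acomm_eq_zero_iff {X Y : Module.End ℂ W} :
    acomm X Y = 0 ↔ ∀ v, X (Y v) = -Y (X v) := by
  rw [← zero_smul ℂ (1 : Module.End ℂ W), acomm_eq_iff]
  simp

/-- The fermions `f_j` on the chain, extended by zero. -/
def fN (N j : ℕ) : Module.End ℂ (V N) := if h : j < N then phase j • jw ⟨j, h⟩ 1 else 0

/-- The fermions `f_j†` on the chain, extended by zero. -/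
def fdN (N j : ℕ) : Module.End ℂ (V N) := if h : j < N then phase j • jw ⟨j, h⟩ 0 else 0

variable {N : ℕ}

lemma acomm_fN_fN (p q : ℕ) : acomm (fN N p) (fN N q) = 0 := by
  simp only [fN]
  split_ifs with hp hq hq
  · simp only [map_smul, LinearMap.smul_apply]
    obtain rfl | hpq := eq_or_ne p q
    · rw [acomm_eq_zero_iff.2 fun v => by simp [jw_jw_self]]; simp
    · rw [acomm_eq_zero_iff.2 fun v => jw_anticomm_of_ne (by simpa using hpq) _ _ v]; simp
  all_goals simp

lemma acomm_fdN_fdN (p q : ℕ) : acomm (fdN N p) (fdN N q) = 0 := by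
  simp only [fdN]
  split_ifs with hp hq hq
  · simp only [map_smul, LinearMap.smul_apply]
    obtain rfl | hpq := eq_or_ne p q
    · rw [acomm_eq_zero_iff.2 fun v => by simp [jw_jw_self]]; simp
    · rw [acomm_eq_zero_iff.2 fun v => jw_anticomm_of_ne (by simpa using hpq) _ _ v]; simp
  all_goals simp

lemma acomm_fdN_fN (p q : ℕ) :
    acomm (fdN N p) (fN N q) = (if p = q ∧ p < N then (-1) ^ (p + 1) else 0 : ℂ) • 1 := by
  simp only [fdN, fN]
  split_ifs with hp hq hpq hpq hpq hq hpq
  · obtain ⟨rfl, -⟩ := hpq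
    simp only [map_smul, LinearMap.smul_apply]
    rw [(acomm_eq_iff (t := 1)).2 fun v => by simp [jw_zero_one], smul_smul, smul_smul,
      phase_mul_self, mul_one]
  · have : p ≠ q := fun h => hpq ⟨h, hp⟩
    simp only [map_smul, LinearMap.smul_apply]
    rw [acomm_eq_zero_iff.2 fun v => jw_anticomm_of_ne (by simpa using this) _ _ v]
    simp
  · omega
  all_goals simp
  all_goals omega

/-- Partial sums of `f_j`. -/
def aOp (N i : ℕ) : Module.End ℂ (V N) := ∑ j ∈ Finset.range (2 * i + 2), fN N j

/-- Sums of two consecutive `f_j`. -/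
def bOp (N i : ℕ) : Module.End ℂ (V N) := fN N (2 * i + 1) + fN N (2 * i + 2)

/-- Partial sums of `f_j†`. -/
def adOp (N i : ℕ) : Module.End ℂ (V N) := ∑ j ∈ Finset.range (2 * i + 2), fdN N j

/-- Sums of two consecutive `f_j†`. -/
def bdOp (N i : ℕ) : Module.End ℂ (V N) := fdN N (2 * i + 1) + fdN N (2 * i + 2)

/-- The position of a pair of modes along the chain. -/
def pairIdx {n : ℕ} (o : Option (Fin n)) : ℕ := o.elim n Fin.val

lemma pairIdx_le {n : ℕ} (o : Option (Fin n)) : pairIdx o ≤ n := by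
  cases o with
  | none => exact le_rfl
  | some i => exact i.2.le

lemma pairIdx_injective {n : ℕ} : Function.Injective (pairIdx (n := n)) := by
  intro o o' h
  cases o with
  | none =>
    cases o' with
    | none => rfl
    | some j => have := j.2; simp [pairIdx] at h; omega
  | some i =>
    cases o' with
    | none => have := i.2; simp [pairIdx] at h; omega
    | some j => simpa [pairIdx, Fin.ext_iff] using h

/-- The creation operators adapted to the periodic Temperley–Lieb algebra. -/
def chainC (N n : ℕ) (p : Mode (Fin n)) : Module.End ℂ (V N) :=
  if p.2 then bOp N (pairIdx p.1) else aOp N (pairIdx p.1)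

/-- The annihilation operators dual to `chainC`. -/
def chainD (N n : ℕ) (p : Mode (Fin n)) : Module.End ℂ (V N) :=
  if p.2 then adOp N (pairIdx p.1)
  else bdOp N (pairIdx p.1) - if pairIdx p.1 = n then adOp N n else 0

lemma sum_signs_eq_zero (i k : ℕ) : ∑ p ∈ Finset.range (2 * i + 2),
    (if p < 2 * k + 2 then (-1) ^ (p + 1) else 0 : ℂ) = 0 := by
  induction i with
  | zero => simp [Finset.sum_range_succ]
  | succ i ih =>
    rw [show 2 * (i + 1) + 2 = 2 * i + 2 + 1 + 1 by ring, Finset.sum_range_succ,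
      Finset.sum_range_succ, ih]
    by_cases h : i + 1 ≤ k
    · rw [if_pos (by omega), if_pos (by omega)]
      ring
    · rw [if_neg (by omega), if_neg (by omega)]
      simp

lemma neg_one_pow_odd_index (i : ℕ) : (-1 : ℂ) ^ (2 * i + 1 + 1) = 1 := by
  rw [show 2 * i + 1 + 1 = 2 * (i + 1) by ring, pow_mul]; simp

lemma neg_one_pow_even_index (i : ℕ) : (-1 : ℂ) ^ (2 * i + 2 + 1) = -1 := by
  rw [show 2 * i + 2 + 1 = 2 * (i + 1) + 1 by ring, pow_succ, pow_mul]; simp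

lemma acomm_fdN_aOp {k : ℕ} (hk : 2 * k + 2 ≤ N) (p : ℕ) :
    acomm (fdN N p) (aOp N k) = (if p < 2 * k + 2 then (-1) ^ (p + 1) else 0 : ℂ) • 1 := by
  simp only [aOp, map_sum, acomm_fdN_fN, ← Finset.sum_smul]
  congr 1
  by_cases h : p < 2 * k + 2
  · rw [Finset.sum_eq_single p (fun q _ hq => by simp [hq.symm]) (by simp [h]), if_pos h,
      if_pos ⟨rfl, by omega⟩]
  · rw [if_neg h, Finset.sum_eq_zero]
    intro q hq
    rw [Finset.mem_range] at hq
    rw [if_neg (by omega)]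

lemma acomm_adOp_fN {k : ℕ} (hk : 2 * k + 2 ≤ N) (p : ℕ) :
    acomm (adOp N k) (fN N p) = (if p < 2 * k + 2 then (-1) ^ (p + 1) else 0 : ℂ) • 1 := by
  simp only [adOp, map_sum, LinearMap.sum_apply, acomm_fdN_fN, ← Finset.sum_smul]
  congr 1
  by_cases h : p < 2 * k + 2
  · rw [Finset.sum_eq_single p (fun q _ hq => by simp [hq]) (by simp [h]), if_pos h,
      if_pos ⟨rfl, by omega⟩]
  · rw [if_neg h, Finset.sum_eq_zero]
    intro q hq
    rw [Finset.mem_range] at hq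
    rw [if_neg (by omega)]

lemma acomm_adOp_aOp {k : ℕ} (hk : 2 * k + 2 ≤ N) (i : ℕ) :
    acomm (adOp N i) (aOp N k) = 0 := by
  simp only [adOp, map_sum, LinearMap.sum_apply, acomm_fdN_aOp hk, ← Finset.sum_smul,
    sum_signs_eq_zero, zero_smul]

lemma acomm_bdOp_aOp {k : ℕ} (hk : 2 * k + 2 ≤ N) (i : ℕ) :
    acomm (bdOp N i) (aOp N k) = (if i = k then 1 else 0 : ℂ) • 1 := by
  rw [bdOp, map_add, LinearMap.add_apply, acomm_fdN_aOp hk, acomm_fdN_aOp hk, ← add_smul,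
    neg_one_pow_odd_index, neg_one_pow_even_index]
  congr 1
  obtain h | h | h := lt_trichotomy i k
  · rw [if_pos (by omega), if_pos (by omega), if_neg (by omega)]; ring
  · rw [if_pos (by omega), if_neg (by omega), if_pos (by omega)]; ring
  · rw [if_neg (by omega), if_neg (by omega), if_neg (by omega)]; ring

lemma acomm_adOp_bOp {i : ℕ} (hi : 2 * i + 2 ≤ N) (k : ℕ) :
    acomm (adOp N i) (bOp N k) = (if i = k then 1 else 0 : ℂ) • 1 := by
  rw [bOp, map_add, acomm_adOp_fN hi, acomm_adOp_fN hi, ← add_smul,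
    neg_one_pow_odd_index, neg_one_pow_even_index]
  congr 1
  obtain h | h | h := lt_trichotomy i k
  · rw [if_neg (by omega), if_neg (by omega), if_neg (by omega)]; ring
  · rw [if_pos (by omega), if_neg (by omega), if_pos (by omega)]; ring
  · rw [if_pos (by omega), if_pos (by omega), if_neg (by omega)]; ring

lemma acomm_bdOp_bOp {i : ℕ} (hi : 2 * i + 2 ≤ N) (k : ℕ) :
    acomm (bdOp N i) (bOp N k) = (if i = k ∧ 2 * i + 2 = N then 1 else 0 : ℂ) • 1 := by
  rw [bdOp, bOp]
  simp only [map_add, LinearMap.add_apply, acomm_fdN_fN, ← add_smul, neg_one_pow_odd_index,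
    neg_one_pow_even_index]
  congr 1
  rw [if_neg (show ¬(2 * i + 1 = 2 * k + 2 ∧ 2 * i + 1 < N) by omega),
    if_neg (show ¬(2 * i + 2 = 2 * k + 1 ∧ 2 * i + 2 < N) by omega)]
  by_cases h : i = k
  · rw [if_pos (show 2 * i + 1 = 2 * k + 1 ∧ 2 * i + 1 < N by omega)]
    by_cases h' : 2 * i + 2 = N
    · rw [if_neg (by omega), if_pos ⟨h, h'⟩]; ring
    · rw [if_pos (by omega), if_neg (by omega)]; ring
  · rw [if_neg (by omega), if_neg (by omega), if_neg (by omega)]; ring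

lemma chain_car {n : ℕ} (hN : N = 2 * n + 2) : CAR (chainC N n) (chainD N n) where
  cc p q := by
    rw [← acomm_eq_zero_iff]
    obtain ⟨o, β⟩ := p
    obtain ⟨o', β'⟩ := q
    cases β <;> cases β' <;> simp [chainC, aOp, bOp, acomm_fN_fN]
  dd p q := by
    rw [← acomm_eq_zero_iff]
    obtain ⟨o, β⟩ := p
    obtain ⟨o', β'⟩ := q
    cases β <;> cases β' <;> simp only [chainD] <;> split_ifs <;>
      simp [adOp, bdOp, acomm_fdN_fdN]
  dc p q := by
    suffices acomm (chainD N n p) (chainC N n q) = (if p = q then 1 else 0 : ℂ) • 1 by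
      intro v
      rw [acomm_eq_iff.1 this]
      split_ifs <;> simp
    obtain ⟨o, β⟩ := p
    obtain ⟨o', β'⟩ := q
    have ho := pairIdx_le o
    have ho' := pairIdx_le o'
    simp only [Prod.mk.injEq, ← pairIdx_injective.eq_iff]
    cases β <;> cases β' <;> simp only [chainD, chainC, if_true, if_false, reduceCtorEq, and_true,
      and_false, Bool.false_eq_true]
    · rw [map_sub, LinearMap.sub_apply, acomm_bdOp_aOp (by omega)]
      split_ifs <;> simp [acomm_adOp_aOp (show 2 * pairIdx o' + 2 ≤ N by omega)]
    · rw [map_sub, LinearMap.sub_apply, acomm_bdOp_bOp (by omega)]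
      by_cases h : pairIdx o = n
      · rw [if_pos h, acomm_adOp_bOp (by omega), h]
        simp [hN]
      · rw [if_neg h, if_neg (by omega)]
        simp
    · rw [acomm_adOp_aOp (by omega)]; simp
    · rw [acomm_adOp_bOp (by omega)]

end Modes

section ChainFock

variable {N : ℕ}

/-- The operator counting the down spins. -/
def numOp (N : ℕ) : Module.End ℂ (V N) where
  toFun v x := downs x * v x
  map_add' u v := by funext x; simp [mul_add]
  map_smul' t v := by funext x; simp [mul_left_comm]

lemma numOp_apply (v : V N) (x : Fin N → Fin 2) : numOp N v x = downs x * v x := rfl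

lemma comm_numOp_jw_one (j : Fin N) : comm (numOp N) (jw j 1) = jw j 1 := by
  refine LinearMap.ext fun v => funext fun x => ?_
  simp only [comm_apply, LinearMap.sub_apply, Module.End.mul_apply, Pi.sub_apply, numOp_apply,
    jw_apply]
  split_ifs with h
  · rw [downs_update h]
    push_cast
    ring
  · simp

lemma comm_numOp_jw_zero (j : Fin N) : comm (numOp N) (jw j 0) = -jw j 0 := by
  refine LinearMap.ext fun v => funext fun x => ?_
  simp only [comm_apply, LinearMap.sub_apply, Module.End.mul_apply, Pi.sub_apply, numOp_apply,
    jw_apply, LinearMap.neg_apply, Pi.neg_apply]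
  split_ifs with h
  · have := downs_update (x := Function.update x j 1) (j := j) (by simp)
    rw [Function.update_idem, show Function.update x j 0 = x from h ▸ Function.update_eq_self j x]
      at this
    rw [show (1 - 0 : Fin 2) = 1 from rfl, this]
    push_cast
    ring
  · simp

lemma comm_numOp_fN (j : ℕ) : comm (numOp N) (fN N j) = fN N j := by
  rw [fN]
  split_ifs
  · rw [map_smul, comm_numOp_jw_one]
  · simp

lemma comm_numOp_fdN (j : ℕ) : comm (numOp N) (fdN N j) = -fdN N j := by
  rw [fdN]
  split_ifs
  · rw [map_smul, comm_numOp_jw_zero, smul_neg]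
  · simp

/-- The state with all spins up. -/
def vacuum (N : ℕ) : V N := Pi.single 0 1

lemma fdN_vacuum (j : ℕ) : fdN N j (vacuum N) = 0 := by
  rw [fdN]
  split_ifs with h
  · funext x
    have : Function.update x ⟨j, h⟩ 1 ≠ 0 := fun h0 => by simpa using congrFun h0 ⟨j, h⟩
    simp [jw_apply, vacuum, this]
  · simp

lemma eq_smul_vacuum {v : V N} (hv : ∀ j, fdN N j v = 0) : v = v 0 • vacuum N := by
  funext x
  by_cases hx : x = 0
  · simp [hx, vacuum]
  obtain ⟨j, hj⟩ := Function.ne_iff.1 hx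
  replace hj : x j = 1 := by
    revert hj
    simp only [Pi.zero_apply]
    generalize x j = b
    fin_cases b <;> simp
  have h0 := congrFun (hv j) (Function.update x j 0)
  have hs : jwSign j (Function.update x j 0) ≠ 0 :=
    left_ne_zero_of_mul_eq_one (jwSign_mul_self _ _)
  rw [fdN, dif_pos j.2] at h0
  simp only [LinearMap.smul_apply, Pi.smul_apply, jw_apply, Function.update_self, if_true,
    Function.update_idem, sub_zero, ← hj, Function.update_eq_self, smul_eq_mul, Pi.zero_apply,
    mul_eq_zero, phase_ne_zero, false_or] at h0
  simp [vacuum, hx, h0.resolve_left hs]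

lemma chain_fockRep {n : ℕ} (hN : N = 2 * n + 2) :
    FockRep (chainC N n) (chainD N n) (numOp N) (vacuum N) where
  toCAR := chain_car hN
  num_c p v := by
    have : comm (numOp N) (chainC N n p) = chainC N n p := by
      rw [chainC]
      split_ifs <;> simp [aOp, bOp, comm_numOp_fN]
    have := LinearMap.congr_fun this v
    rwa [comm_apply, LinearMap.sub_apply, sub_eq_iff_eq_add'] at this
  num_d p v := by
    have : comm (numOp N) (chainD N n p) = -chainD N n p := by
      rw [chainD]
      split_ifs <;> simp [adOp, bdOp, comm_numOp_fdN] <;> abel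
    have := LinearMap.congr_fun this v
    rwa [comm_apply, LinearMap.sub_apply, sub_eq_iff_eq_add', LinearMap.neg_apply,
      ← sub_eq_add_neg] at this
  num_vac := by
    funext x
    by_cases hx : x = 0
    · simp [numOp_apply, hx, downs]
    · simp [numOp_apply, vacuum, hx]
  vac_ne_zero h := by simpa [vacuum] using congrFun h 0
  d_vac p := by
    rw [chainD]
    split_ifs <;> simp [adOp, bdOp, fdN_vacuum]
  exists_smul_vac v hv := by
    refine ⟨v 0, eq_smul_vacuum ?_⟩
    have hidx : ∀ i ≤ n, ∃ o : Option (Fin n), pairIdx o = i := fun i hi => by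
      obtain h | rfl := hi.lt_or_eq
      · exact ⟨some ⟨i, h⟩, rfl⟩
      · exact ⟨none, rfl⟩
    have had : ∀ i ≤ n, adOp N i v = 0 := by
      intro i hi
      obtain ⟨o, rfl⟩ := hidx i hi
      simpa [chainD] using hv (o, true)
    have hbd : ∀ i ≤ n, bdOp N i v = 0 := by
      intro i hi
      obtain ⟨o, rfl⟩ := hidx i hi
      have := hv (o, false)
      by_cases h : pairIdx o = n <;> simpa [chainD, h, had n le_rfl] using this
    have hsum : ∀ j ≤ 2 * n + 1, fdN N j v = -fdN N (j + 1) v := by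
      intro j hj
      rw [eq_neg_iff_add_eq_zero]
      obtain ⟨i, rfl | rfl⟩ := j.even_or_odd'
      · obtain rfl | hi := i.eq_zero_or_pos
        · simpa [adOp, Finset.sum_range_succ] using had 0 n.zero_le
        · obtain ⟨i, rfl⟩ := Nat.exists_eq_add_of_lt hi
          have h1 := had (i + 1) (by omega)
          have h2 := had i (by omega)
          rw [adOp] at h1 h2
          rw [show 2 * (i + 1) + 2 = 2 * i + 2 + 1 + 1 by ring, Finset.sum_range_succ,
            Finset.sum_range_succ, LinearMap.add_apply, LinearMap.add_apply, h2, zero_add] at h1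
          rw [← h1, show 2 * (0 + i + 1) = 2 * i + 2 by ring]
      · exact hbd i (by omega)
    have hall : ∀ l ≤ 2 * n + 2, fdN N (2 * n + 2 - l) v = 0 := by
      intro l
      induction l with
      | zero => intro _; rw [fdN, dif_neg (by omega)]; simp
      | succ l ih =>
        intro hl
        rw [hsum _ (by omega), show 2 * n + 2 - (l + 1) + 1 = 2 * n + 2 - l by omega,
          ih (by omega), neg_zero]
    intro j
    by_cases hj : j ≤ 2 * n + 2
    · have := hall (2 * n + 2 - j) (by omega)
      rwa [Nat.sub_sub_self hj] at this
    · rw [fdN, dif_neg (by omega)]; simp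

end ChainFock

section ChainGenerators

variable {N n : ℕ}

lemma toLin_f_eq_fN (j : Fin N) : Matrix.toLinAlgEquiv' (f N j) = fN N j := by
  rw [toLin_f, fN, dif_pos j.2]

lemma toLin_fd_eq_fdN (j : Fin N) : Matrix.toLinAlgEquiv' (fd N j) = fdN N j := by
  rw [toLin_fd, fdN, dif_pos j.2]

lemma toLin_e (j : Fin N) : Matrix.toLinAlgEquiv' (e N j) =
    (fN N j + fN N ((j + 1) % N)) * (fdN N j + fdN N ((j + 1) % N)) := by
  simp only [e, map_mul, map_add, toLin_f_eq_fN, toLin_fd_eq_fdN, fsucc]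

lemma toLin_e_of_lt {j : ℕ} (hj : j + 1 < N) : Matrix.toLinAlgEquiv' (e N ⟨j, by omega⟩) =
    (fN N j + fN N (j + 1)) * (fdN N j + fdN N (j + 1)) := by
  rw [toLin_e, Nat.mod_eq_of_lt hj]

lemma sum_range_even_add_two {A : Type*} [AddCommMonoid A] (g : ℕ → A) (n : ℕ) :
    ∑ j ∈ Finset.range (2 * n + 2), g j
      = ∑ i ∈ Finset.range n, (g (2 * i + 1) + g (2 * i + 2)) + (g (2 * n + 1) + g 0) := by
  induction n with
  | zero => simp [Finset.sum_range_succ, add_comm]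
  | succ n ih =>
    rw [show 2 * (n + 1) + 2 = 2 * n + 2 + 1 + 1 by ring, Finset.sum_range_succ,
      Finset.sum_range_succ, ih, Finset.sum_range_succ, show 2 * (n + 1) + 1 = 2 * n + 3 by ring]
    abel

lemma chainC_aMode {i : ℕ} (hi : i ≤ n) : chainC N n (aMode n i) = aOp N i := by
  obtain h | rfl := hi.lt_or_eq
  · rw [aMode_of_lt h]; rfl
  · rw [aMode_self]; rfl

lemma chainD_bMode {i : ℕ} (hi : i ≤ n) : chainD N n (bMode n i) = adOp N i := by
  obtain h | rfl := hi.lt_or_eq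
  · rw [bMode_of_lt h]; rfl
  · rw [bMode_self]; rfl

lemma chainD_am (i : Fin n) : chainD N n (am i) = bdOp N i := by
  simp [chainD, pairIdx, i.2.ne]

/-- A subalgebra containing the periodic Temperley–Lieb generators contains the symmetric
operators. -/
lemma SymOp.mem_of_e_mem (hN : N = 2 * n + 2) {S : Subalgebra ℂ (Module.End ℂ (V N))}
    (hS : ∀ j, Matrix.toLinAlgEquiv' (e N j) ∈ S) {X : Module.End ℂ (V N)}
    (hX : SymOp (chainC N n) (chainD N n) X) : X ∈ S := by
  have hS' : ∀ j, j + 1 < N → (fN N j + fN N (j + 1)) * (fdN N j + fdN N (j + 1)) ∈ S :=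
    fun j hj => toLin_e_of_lt hj ▸ hS _
  refine hX.mem_of_generators (chain_car hN) ?_ ?_ ?_ ?_
  · rw [chainC_aMode n.zero_le, chainD_bMode n.zero_le]
    simpa [aOp, adOp, Finset.sum_range_succ] using hS' 0 (by omega)
  · intro i hi
    rw [chainC_aMode hi, chainC_aMode hi.le, chainD_bMode hi, chainD_bMode hi.le]
    convert hS' (2 * i + 2) (by omega) using 1
    simp only [aOp, adOp, show 2 * (i + 1) + 2 = 2 * i + 2 + 1 + 1 by ring, Finset.sum_range_succ]
    congr 1 <;> abel
  · intro i
    rw [chainD_am]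
    exact hS' (2 * i + 1) (by omega)
  · have hlast := hS ⟨2 * n + 1, by omega⟩
    rw [toLin_e, show (2 * n + 1 + 1) % N = 0 by rw [hN]; exact Nat.mod_self _] at hlast
    simp only [chainD_am]
    convert hlast using 1
    change (aOp N n - ∑ i : Fin n, bOp N i) * (adOp N n - ∑ i : Fin n, bdOp N i) = _
    rw [Fin.sum_univ_eq_sum_range (bOp N), Fin.sum_univ_eq_sum_range (bdOp N), aOp, adOp,
      sum_range_even_add_two, sum_range_even_add_two]
    simp only [bOp, bdOp, add_sub_cancel_left]

end ChainGenerators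

section OrderedSums

variable {A : Type*} [Ring A]

/-- The sum of the products `x_{j_1} ⋯ x_{j_m}` over `j_1 < ⋯ < j_m < l`. -/
def ordSum (x : ℕ → A) : ℕ → ℕ → A
  | _, 0 => 1
  | 0, _ + 1 => 0
  | l + 1, m + 1 => ordSum x l (m + 1) + ordSum x l m * x l

lemma ordSum_zero_right (x : ℕ → A) (l : ℕ) : ordSum x l 0 = 1 := by cases l <;> rfl

lemma ordSum_zero_succ (x : ℕ → A) (m : ℕ) : ordSum x 0 (m + 1) = 0 := rfl

lemma ordSum_succ_succ (x : ℕ → A) (l m : ℕ) :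
    ordSum x (l + 1) (m + 1) = ordSum x l (m + 1) + ordSum x l m * x l := rfl

lemma ordSum_one (x : ℕ → A) (l : ℕ) : ordSum x l 1 = ∑ j ∈ Finset.range l, x j := by
  induction l with
  | zero => rfl
  | succ l ih => rw [ordSum_succ_succ, ih, ordSum_zero_right, Finset.sum_range_succ, one_mul]

lemma ordSum_eq_zero_of_lt (x : ℕ → A) {l m : ℕ} (h : l < m) : ordSum x l m = 0 := by
  induction l generalizing m with
  | zero => obtain ⟨m, rfl⟩ := Nat.exists_eq_succ_of_ne_zero h.ne'; rfl
  | succ l ih =>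
    obtain ⟨m, rfl⟩ := Nat.exists_eq_succ_of_ne_zero (Nat.ne_zero_of_lt h)
    rw [ordSum_succ_succ, ih (by omega), ih (by omega), zero_mul, add_zero]

lemma ordSum_succ_self (x : ℕ → A) (l : ℕ) :
    ordSum x (l + 1) (l + 1) = ordSum x l l * x l := by
  rw [ordSum_succ_succ, ordSum_eq_zero_of_lt x l.lt_succ_self, zero_add]

lemma sort_insert_of_forall_lt {ι : Type*} [LinearOrder ι] {s : Finset ι} {a : ι}
    (h : ∀ b ∈ s, b < a) : (insert a s).sort (· ≤ ·) = s.sort (· ≤ ·) ++ [a] := by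
  have ha : a ∉ s := fun hm => (h a hm).false
  refine List.Perm.eq_of_pairwise' (r := (· ≤ ·)) (Finset.pairwise_sort _ _) ?_ ?_
  · rw [List.pairwise_append]
    refine ⟨Finset.pairwise_sort _ _, by simp, ?_⟩
    intro b hb c hc
    rw [Finset.mem_sort] at hb
    rw [List.mem_singleton] at hc
    exact hc ▸ (h b hb).le
  · rw [← Multiset.coe_eq_coe, Finset.sort_eq, Finset.insert_val_of_notMem ha, ← Multiset.coe_add,
      Finset.sort_eq, Multiset.coe_singleton, add_comm, Multiset.singleton_add]

lemma sum_powersetCard_eq_ordSum {N : ℕ} (x : ℕ → A) {l : ℕ} (hl : l ≤ N) (m : ℕ) :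
    ∑ s ∈ (Finset.univ.filter fun j : Fin N => (j : ℕ) < l).powersetCard m,
      ((s.sort (· ≤ ·)).map fun j : Fin N => x j).prod = ordSum x l m := by
  induction l generalizing m with
  | zero =>
    cases m with
    | zero => simp [ordSum]
    | succ m =>
      rw [Finset.powersetCard_eq_empty.2 (by simp), Finset.sum_empty, ordSum_zero_succ]
  | succ l ih =>
    cases m with
    | zero => simp [ordSum]
    | succ m =>
      set a : Fin N := ⟨l, hl⟩
      set s := Finset.univ.filter fun j : Fin N => (j : ℕ) < l with hs
      have hlt : ∀ b ∈ s, b < a := fun b hb => by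
        exact Fin.lt_def.2 (Finset.mem_filter.1 hb).2
      have ha : a ∉ s := fun h => (hlt a h).false
      have hins : (Finset.univ.filter fun j : Fin N => (j : ℕ) < l + 1) = insert a s := by
        ext j
        simp only [hs, Finset.mem_filter, Finset.mem_univ, true_and, Finset.mem_insert,
          Fin.ext_iff, a]
        omega
      rw [hins, Finset.powersetCard_succ_insert ha, Finset.sum_union, ih (by omega),
        ordSum_succ_succ, ← ih (by omega) m, Finset.sum_mul, Finset.sum_image]
      · congr 1
        refine Finset.sum_congr rfl fun t ht => ?_
        rw [sort_insert_of_forall_lt fun b hb => hlt b ((Finset.mem_powersetCard.1 ht).1 hb)]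
        simp [a]
      · intro t ht t' ht' h
        have h1 : a ∉ t := fun h => ha ((Finset.mem_powersetCard.1 ht).1 h)
        have h2 : a ∉ t' := fun h => ha ((Finset.mem_powersetCard.1 ht').1 h)
        rw [← Finset.erase_insert h1, ← Finset.erase_insert h2]
        exact congrArg (Finset.erase · a) h
      · rw [Finset.disjoint_left]
        intro t ht ht'
        obtain ⟨u, -, rfl⟩ := Finset.mem_image.1 ht'
        exact ha ((Finset.mem_powersetCard.1 ht).1 (Finset.mem_insert_self a u))

lemma add_pow_of_sq_eq_zero {a b : A} (h : Commute a b) (hb : b * b = 0) (j : ℕ) :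
    (a + b) ^ (j + 1) = a ^ (j + 1) + (j + 1) • (a ^ j * b) := by
  induction j with
  | zero => simp
  | succ j ih =>
    have h1 : a ^ j * b * a = a ^ (j + 1) * b := by rw [mul_assoc, ← h.eq, ← mul_assoc, pow_succ]
    have h2 : a ^ j * b * b = 0 := by rw [mul_assoc, hb, mul_zero]
    rw [pow_succ, ih, add_mul, mul_add, mul_add, smul_mul_assoc, smul_mul_assoc, h1, h2,
      ← pow_succ, smul_zero, add_zero, add_assoc, ← succ_nsmul']

lemma mul_add_pow_of_mul_eq_zero {y a b : A} (h : Commute a b) (hy : y * b = 0) (j : ℕ) :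
    y * (a + b) ^ j = y * a ^ j := by
  induction j with
  | zero => simp
  | succ j ih =>
    rw [pow_succ, ← mul_assoc, ih, mul_add, mul_assoc y _ b, (h.pow_left j).eq, ← mul_assoc y b,
      hy, zero_mul, add_zero, mul_assoc, ← pow_succ]

variable {x : ℕ → A}

lemma ordSum_one_mul (hx : ∀ p q, x p * x q = -(x q * x p)) (l k : ℕ) :
    ordSum x l 1 * x k = -(x k * ordSum x l 1) := by
  simp only [ordSum_one, Finset.sum_mul, Finset.mul_sum, ← Finset.sum_neg_distrib]
  exact Finset.sum_congr rfl fun p _ => hx p k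

lemma ordSum_one_mul_self (hx : ∀ p q, x p * x q = -(x q * x p)) (hx0 : ∀ p, x p * x p = 0)
    (l : ℕ) : ordSum x l 1 * ordSum x l 1 = 0 := by
  induction l with
  | zero => simp [ordSum]
  | succ l ih =>
    rw [ordSum_succ_succ, ordSum_zero_right, one_mul, add_mul, mul_add, mul_add, ih, hx0,
      ordSum_one_mul hx]
    simp

lemma commute_ordSum_two (hx : ∀ p q, x p * x q = -(x q * x p)) (l k : ℕ) :
    Commute (ordSum x l 2) (x k) := by
  induction l with
  | zero => exact Commute.zero_left _
  | succ l ih =>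
    rw [ordSum_succ_succ]
    refine ih.add_left ?_
    rw [Commute, SemiconjBy, mul_assoc, hx, mul_neg, ← mul_assoc, ordSum_one_mul hx, neg_mul,
      neg_neg, mul_assoc]

lemma commute_ordSum_two_one (hx : ∀ p q, x p * x q = -(x q * x p)) (l k : ℕ) :
    Commute (ordSum x l 2) (ordSum x k 1) := by
  rw [ordSum_one]
  exact Commute.sum_right _ _ _ fun p _ => commute_ordSum_two hx l p

lemma factorial_smul_ordSum (hx : ∀ p q, x p * x q = -(x q * x p)) (hx0 : ∀ p, x p * x p = 0)
    (l j : ℕ) :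
    j.factorial • ordSum x l (2 * j) = ordSum x l 2 ^ j ∧
    j.factorial • ordSum x l (2 * j + 1) = ordSum x l 1 * ordSum x l 2 ^ j := by
  induction l generalizing j with
  | zero => cases j <;> simp [ordSum, mul_add]
  | succ l ih =>
    have hc := (commute_ordSum_two_one hx l l).mul_right (commute_ordSum_two hx l l)
    have hxσ : x l * (ordSum x l 1 * x l) = 0 := by
      rw [ordSum_one_mul hx, mul_neg, ← mul_assoc, hx0, zero_mul, neg_zero]
    have hσ : ordSum x l 1 * (ordSum x l 1 * x l) = 0 := by
      rw [← mul_assoc, ordSum_one_mul_self hx hx0, zero_mul]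
    have hsq : ordSum x l 1 * x l * (ordSum x l 1 * x l) = 0 := by rw [mul_assoc, hxσ, mul_zero]
    constructor
    · cases j with
      | zero => simp [ordSum_zero_right]
      | succ j =>
        rw [show 2 * (j + 1) = 2 * j + 1 + 1 by ring, ordSum_succ_succ, ordSum_succ_succ x l 1,
          add_pow_of_sq_eq_zero hc hsq, smul_add, show 2 * j + 1 + 1 = 2 * (j + 1) by ring,
          (ih (j + 1)).1, Nat.factorial_succ, mul_smul, ← smul_mul_assoc, (ih j).2,
          ← ((commute_ordSum_two_one hx l l).pow_left j).eq, mul_assoc]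
    · rw [ordSum_succ_succ, ordSum_succ_succ x l 1, ordSum_succ_succ x l 0, ordSum_zero_right,
        one_mul, mul_add_pow_of_mul_eq_zero hc (by rw [add_mul, hxσ, hσ, add_zero]), smul_add,
        (ih j).2, ← smul_mul_assoc, (ih j).1, ((commute_ordSum_two hx l l).pow_left j).eq, add_mul]

lemma ordSum_two_even (hx0 : ∀ p, x p * x p = 0) (n : ℕ) :
    ordSum x (2 * n + 2) 2 =
      ∑ i ∈ Finset.range n, ordSum x (2 * i + 2) 1 * (x (2 * i + 1) + x (2 * i + 2))
        + ordSum x (2 * n + 2) 1 * x (2 * n + 1) := by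
  induction n with
  | zero => simp [ordSum, add_mul, hx0]
  | succ n ih =>
    rw [show 2 * (n + 1) + 2 = 2 * n + 2 + 1 + 1 by ring, ordSum_succ_succ, ordSum_succ_succ x _ 1,
      ih, Finset.sum_range_succ, show 2 * (n + 1) + 1 = 2 * n + 2 + 1 by ring,
      ordSum_succ_succ x (2 * n + 2 + 1) 0, ordSum_zero_right, one_mul, add_mul _ (x _), hx0,
      add_zero, mul_add]
    abel

lemma factorial_smul_ordSum_odd (hx : ∀ p q, x p * x q = -(x q * x p))
    (hx0 : ∀ p, x p * x p = 0) (n j : ℕ) :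
    j.factorial • ordSum x (2 * n + 2) (2 * j + 1) = ordSum x (2 * n + 2) 1 *
      (∑ i ∈ Finset.range n, ordSum x (2 * i + 2) 1 * (x (2 * i + 1) + x (2 * i + 2))) ^ j := by
  have hτ := ordSum_two_even hx0 n
  have hc := (commute_ordSum_two_one hx (2 * n + 2) (2 * n + 2)).mul_right
    (commute_ordSum_two hx (2 * n + 2) (2 * n + 1))
  rw [(factorial_smul_ordSum hx hx0 _ j).2, hτ]
  refine mul_add_pow_of_mul_eq_zero ?_ ?_ j
  · rw [← sub_eq_iff_eq_add] at hτ
    exact hτ ▸ hc.sub_left (Commute.refl _)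
  · rw [← mul_assoc, ordSum_one_mul_self hx hx0, zero_mul]

end OrderedSums

section Images

variable {N n : ℕ}

lemma toLin_Fg (m : ℕ) : Matrix.toLinAlgEquiv' (Fg N m) = ordSum (fN N) N m := by
  have huniv : (Finset.univ.filter fun j : Fin N => (j : ℕ) < N) = Finset.univ := by simp
  rw [← sum_powersetCard_eq_ordSum _ le_rfl, huniv, Fg, map_sum]
  refine Finset.sum_congr rfl fun s _ => ?_
  rw [map_list_prod, List.map_map]
  exact congrArg _ (List.map_congr_left fun j _ => toLin_f_eq_fN j)

lemma toLin_Fdg (m : ℕ) : Matrix.toLinAlgEquiv' (Fdg N m) = ordSum (fdN N) N m := by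
  have huniv : (Finset.univ.filter fun j : Fin N => (j : ℕ) < N) = Finset.univ := by simp
  rw [← sum_powersetCard_eq_ordSum _ le_rfl, huniv, Fdg, map_sum]
  refine Finset.sum_congr rfl fun s _ => ?_
  rw [map_list_prod, List.map_map]
  exact congrArg _ (List.map_congr_left fun j _ => toLin_fd_eq_fdN j)

lemma fN_mul_self (p : ℕ) : fN N p * fN N p = 0 := by
  refine LinearMap.ext fun v => ?_
  exact eq_zero_of_eq_neg (acomm_eq_zero_iff.1 (acomm_fN_fN p p) v)

lemma fdN_mul_self (p : ℕ) : fdN N p * fdN N p = 0 := by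
  refine LinearMap.ext fun v => ?_
  exact eq_zero_of_eq_neg (acomm_eq_zero_iff.1 (acomm_fdN_fdN p p) v)

lemma fN_anticomm (p q : ℕ) : fN N p * fN N q = -(fN N q * fN N p) :=
  eq_neg_of_add_eq_zero_left (acomm_fN_fN p q)

lemma fdN_anticomm (p q : ℕ) : fdN N p * fdN N q = -(fdN N q * fdN N p) :=
  eq_neg_of_add_eq_zero_left (acomm_fdN_fdN p q)

lemma factorial_smul_toLin_Fg (hN : N = 2 * n + 2) (j : ℕ) :
    Matrix.toLinAlgEquiv' (j.factorial • Fg N (2 * j + 1)) =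
      chainC N n Fm * pairUp (chainC N n) ^ j := by
  have h := factorial_smul_ordSum_odd (x := fN N) fN_anticomm fN_mul_self n j
  simp only [ordSum_one] at h
  rw [map_nsmul, toLin_Fg]
  subst hN
  rw [h, pairUp]
  congr 2
  exact (Fin.sum_univ_eq_sum_range (fun i => aOp (2 * n + 2) i * bOp (2 * n + 2) i) n).symm

lemma factorial_smul_toLin_Fdg (hN : N = 2 * n + 2) (j : ℕ) :
    Matrix.toLinAlgEquiv' (j.factorial • Fdg N (2 * j + 1)) =
      chainD N n wm * pairDown (chainD N n) ^ j := by
  have h := factorial_smul_ordSum_odd (x := fdN N) fdN_anticomm fdN_mul_self n j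
  simp only [ordSum_one] at h
  rw [map_nsmul, toLin_Fdg]
  subst hN
  rw [h, pairDown]
  simp only [chainD_am]
  congr 2
  exact (Fin.sum_univ_eq_sum_range (fun i => adOp (2 * n + 2) i * bdOp (2 * n + 2) i) n).symm

/-- The operators of `centOps` lie in the algebra generated by the odd symmetries. -/
lemma centOps_le_adjoin (L : ℕ) (hL : 2 * L = 2 * n + 2) {X : Module.End ℂ (V (2 * L))}
    (hX : X ∈ centOps (chainC (2 * L) n) (chainD (2 * L) n)) :
    Matrix.toLinAlgEquiv'.symm X ∈ Algebra.adjoin ℂ (centGens L) := by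
  have hcar := chain_car hL
  suffices centOps (chainC (2 * L) n) (chainD (2 * L) n) ≤
      ((Algebra.adjoin ℂ (centGens L)).toSubmodule).comap
        (Matrix.toLinAlgEquiv' (R := ℂ) (n := Fin (2 * L) → Fin 2)).symm.toLinearMap from this hX
  rw [centOps, Submodule.span_le]
  rintro _ (rfl | ⟨i, hi, j, hj, rfl⟩)
  · change Matrix.toLinAlgEquiv'.symm 1 ∈ Algebra.adjoin ℂ (centGens L)
    rw [map_one]
    exact one_mem _
  · change Matrix.toLinAlgEquiv'.symm _ ∈ Algebra.adjoin ℂ (centGens L)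
    rw [Fintype.card_fin] at hi hj
    rw [mul_assoc, ← mul_assoc (chainD _ _ wm), (hcar.commute_pairUp_wm.pow_right i).eq,
      mul_assoc, ← mul_assoc, ← factorial_smul_toLin_Fg hL, ← factorial_smul_toLin_Fdg hL,
      ← map_mul, AlgEquiv.symm_apply_apply]
    refine mul_mem (nsmul_mem (Algebra.subset_adjoin ?_) _)
      (nsmul_mem (Algebra.subset_adjoin ?_) _)
    · exact Or.inl ⟨i, by omega, rfl⟩
    · exact Or.inr (Or.inl ⟨j, by omega, rfl⟩)

end Images

section ExtremalStates

variable {W : Type*} [AddCommGroup W] [Module ℂ W] {N : ℕ}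

lemma mul_ordSum_self {x y : ℕ → Module.End ℂ W} (hxy : ∀ p q, p ≠ q → acomm (y p) (x q) = 0)
    {k l : ℕ} (h : l ≤ k) (v : W) :
    y k (ordSum x l l v) = (-1 : ℂ) ^ l • ordSum x l l (y k v) := by
  induction l generalizing v with
  | zero => simp [ordSum]
  | succ l ih =>
    rw [ordSum_succ_self, Module.End.mul_apply, ih (by omega), Module.End.mul_apply,
      acomm_eq_zero_iff.1 (hxy k l (by omega)), map_neg, pow_succ, mul_neg_one, neg_smul, smul_neg]

lemma ordSum_self_apply_ne_zero {x y : ℕ → Module.End ℂ W} {ε : ℕ → ℂ}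
    (hxy : ∀ p q, p ≠ q → acomm (y p) (x q) = 0)
    (hpp : ∀ p < N, acomm (y p) (x p) = ε p • 1) (hε : ∀ p, ε p ≠ 0) {v : W} (hv : v ≠ 0)
    (hyv : ∀ p, y p v = 0) {l : ℕ} (hl : l ≤ N) : ordSum x l l v ≠ 0 := by
  induction l with
  | zero => simpa [ordSum] using hv
  | succ l ih =>
    intro h0
    have h := mul_ordSum_self hxy le_rfl (x l v) (k := l)
    rw [← Module.End.mul_apply (ordSum x l l), ← ordSum_succ_self, h0, map_zero,
      acomm_eq_iff.1 (hpp l hl), hyv, map_zero, sub_zero, map_smul, eq_comm, smul_eq_zero,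
      smul_eq_zero] at h
    rcases h with h | h | h
    · exact pow_ne_zero _ (by norm_num) h
    · exact hε l h
    · exact ih (by omega) h

lemma comm_ordSum {M : Module.End ℂ W} {x : ℕ → Module.End ℂ W} {t : ℂ}
    (hM : ∀ p, comm M (x p) = t • x p) (l : ℕ) :
    comm M (ordSum x l l) = (l * t) • ordSum x l l := by
  induction l with
  | zero => simp [ordSum, comm_apply]
  | succ l ih =>
    have : comm M (ordSum x l l * x l) =
        comm M (ordSum x l l) * x l + ordSum x l l * comm M (x l) := by
      simp only [comm_apply]
      noncomm_ring
    rw [ordSum_succ_self, this, ih, hM, smul_mul_assoc, mul_smul_comm, ← add_smul]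
    push_cast
    ring_nf

/-- The state with all spins down. -/
def fullState (N : ℕ) : V N := Pi.single 1 1

lemma fN_fullState (j : ℕ) : fN N j (fullState N) = 0 := by
  rw [fN]
  split_ifs with h
  · funext x
    have : Function.update x ⟨j, h⟩ 0 ≠ 1 := fun h0 => by simpa using congrFun h0 ⟨j, h⟩
    simp [jw_apply, fullState, this]
  · simp

lemma downs_eq_zero_iff {x : Fin N → Fin 2} : downs x = 0 ↔ x = 0 := by
  rw [downs, Finset.sum_eq_zero_iff, funext_iff]
  exact ⟨fun h j => Fin.val_inj.1 (h j (Finset.mem_univ j)), fun h j _ => Fin.val_inj.2 (h j)⟩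

lemma downs_eq_iff {x : Fin N → Fin 2} : downs x = N ↔ x = 1 := by
  have hle : ∀ j ∈ Finset.univ, (x j : ℕ) ≤ 1 := fun j _ => by omega
  have h := Finset.sum_eq_sum_iff_of_le hle
  simp only [Finset.sum_const, Finset.card_univ, Fintype.card_fin, smul_eq_mul, mul_one,
    Finset.mem_univ, true_imp_iff] at h
  rw [downs, h, funext_iff]
  exact forall_congr' fun j => Fin.val_inj (b := 1)

lemma numOp_eq_smul_iff {v : V N} {k : ℕ} :
    numOp N v = (k : ℂ) • v ↔ ∀ x, downs x ≠ k → v x = 0 := by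
  refine funext_iff.trans (forall_congr' fun x => ?_)
  rw [numOp_apply, Pi.smul_apply, smul_eq_mul, mul_eq_mul_right_iff, Nat.cast_inj,
    or_iff_not_imp_left]

lemma eq_smul_vacuum_of_numOp {v : V N} (hv : numOp N v = ((0 : ℕ) : ℂ) • v) :
    v = v 0 • vacuum N := by
  rw [numOp_eq_smul_iff] at hv
  funext x
  by_cases hx : x = 0
  · simp [hx, vacuum]
  · simp [vacuum, hx, hv x (mt downs_eq_zero_iff.1 hx)]

lemma eq_smul_fullState_of_numOp {v : V N} (hv : numOp N v = (N : ℂ) • v) :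
    v = v 1 • fullState N := by
  rw [numOp_eq_smul_iff] at hv
  funext x
  by_cases hx : x = 1
  · simp [hx, fullState]
  · simp [fullState, hx, hv x (mt downs_eq_iff.1 hx)]

lemma numOp_vacuum : numOp N (vacuum N) = ((0 : ℕ) : ℂ) • vacuum N :=
  numOp_eq_smul_iff.2 fun x hx => by simp [vacuum, mt downs_eq_zero_iff.2 hx]

lemma numOp_fullState : numOp N (fullState N) = (N : ℂ) • fullState N :=
  numOp_eq_smul_iff.2 fun x hx => by simp [fullState, mt downs_eq_iff.2 hx]

lemma exists_eq_smul_of_eq_smul {u v w : W} {a b : ℂ} (hv : v = a • u) (hw : w = b • u)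
    (h0 : w ≠ 0) : ∃ t : ℂ, v = t • w := by
  have hb : b ≠ 0 := fun h => h0 (by rw [hw, h, zero_smul])
  exact ⟨a / b, by rw [hv, hw, smul_smul, div_mul_cancel₀ _ hb]⟩

lemma exists_smul_Fg_vacuum {v : V N} (hv : numOp N v = (N : ℂ) • v) :
    ∃ t : ℂ, v = t • Matrix.toLinAlgEquiv' (Fg N N) (vacuum N) := by
  rw [toLin_Fg]
  refine exists_eq_smul_of_eq_smul (eq_smul_fullState_of_numOp hv)
    (eq_smul_fullState_of_numOp ?_) ?_
  · have := LinearMap.congr_fun (comm_ordSum (M := numOp N) (x := fN N) (t := 1)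
      (fun p => by rw [comm_numOp_fN, one_smul]) N) (vacuum N)
    simpa [comm_apply, numOp_vacuum] using this
  · refine ordSum_self_apply_ne_zero (N := N) (y := fdN N) (ε := fun p => (-1) ^ (p + 1))
      (fun p q h => ?_) (fun p hp => ?_) (fun p => pow_ne_zero _ (by norm_num)) ?_ fdN_vacuum le_rfl
    · simp [acomm_fdN_fN, h]
    · simp [acomm_fdN_fN, hp]
    · exact fun h => by simpa [vacuum] using congrFun h 0

lemma exists_smul_Fdg_fullState {v : V N} (hv : numOp N v = ((0 : ℕ) : ℂ) • v) :
    ∃ t : ℂ, v = t • Matrix.toLinAlgEquiv' (Fdg N N) (fullState N) := by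
  have hsymm : ∀ p q, acomm (fN N p) (fdN N q) = acomm (fdN N q) (fN N p) :=
    fun p q => add_comm _ _
  rw [toLin_Fdg]
  refine exists_eq_smul_of_eq_smul (eq_smul_vacuum_of_numOp hv)
    (eq_smul_vacuum_of_numOp ?_) ?_
  · have := LinearMap.congr_fun (comm_ordSum (M := numOp N) (x := fdN N) (t := -1)
      (fun p => (comm_numOp_fdN p).trans (neg_one_smul ℂ _).symm) N) (fullState N)
    simpa [comm_apply, numOp_fullState, sub_eq_iff_eq_add] using this
  · refine ordSum_self_apply_ne_zero (N := N) (y := fN N) (ε := fun p => (-1) ^ (p + 1))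
      (fun p q h => ?_) (fun p hp => ?_) (fun p => pow_ne_zero _ (by norm_num)) ?_ fN_fullState
      le_rfl
    · simp [hsymm, acomm_fdN_fN, h.symm]
    · simp [hsymm, acomm_fdN_fN, hp]
    · exact fun h => by simpa [fullState] using congrFun h 1

end ExtremalStates

section Intertwiners

variable {N n : ℕ}

/-- Multiplication by a function of the number of down spins. -/
def diagOp (N : ℕ) (g : ℤ → ℂ) : Module.End ℂ (V N) where
  toFun v x := g (downs x) * v x
  map_add' u v := by funext x; simp [mul_add]
  map_smul' t v := by funext x; simp [mul_left_comm]

lemma diagOp_apply (g : ℤ → ℂ) (v : V N) (x : Fin N → Fin 2) :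
    diagOp N g v x = g (downs x) * v x := rfl

lemma fN_diagOp (g : ℤ → ℂ) (p : ℕ) (v : V N) :
    fN N p (diagOp N g v) = diagOp N (fun m => g (m - 1)) (fN N p v) := by
  rw [fN]
  split_ifs with hp
  · funext x
    simp only [LinearMap.smul_apply, Pi.smul_apply, diagOp_apply, jw_apply, smul_eq_mul]
    split_ifs with h
    · rw [downs_update h, show (1 - 1 : Fin 2) = 0 from rfl]
      push_cast
      rw [add_sub_cancel_right]
      ring
    · simp
  · simp

lemma fdN_diagOp (g : ℤ → ℂ) (p : ℕ) (v : V N) :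
    fdN N p (diagOp N g v) = diagOp N (fun m => g (m + 1)) (fdN N p v) := by
  rw [fdN]
  split_ifs with hp
  · funext x
    simp only [LinearMap.smul_apply, Pi.smul_apply, diagOp_apply, jw_apply, smul_eq_mul]
    split_ifs with h
    · have := downs_update (x := Function.update x ⟨p, hp⟩ 1) (j := ⟨p, hp⟩) (by simp)
      rw [Function.update_idem, show Function.update x ⟨p, hp⟩ 0 = x from
        h ▸ Function.update_eq_self _ x] at this
      rw [show (1 - 0 : Fin 2) = 1 from rfl, this]
      push_cast
      ring
    · simp
  · simp

lemma toLin_e_diagOp (g : ℤ → ℂ) (j : Fin N) (v : V N) :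
    Matrix.toLinAlgEquiv' (e N j) (diagOp N g v) =
      diagOp N g (Matrix.toLinAlgEquiv' (e N j) v) := by
  simp only [toLin_e, Module.End.mul_apply, LinearMap.add_apply, map_add, fdN_diagOp, fN_diagOp,
    sub_add_cancel]

lemma mem_sector_iff {L a : ℕ} {v : V (2 * L)} :
    v ∈ sector L a ↔ numOp (2 * L) v = (a : ℂ) • v := by
  rw [sector, Module.End.mem_eigenspace_iff, funext_iff, funext_iff]
  refine forall_congr' fun x => ?_
  rw [Matrix.mulVecLin_apply, Sz_mulVec, numOp_apply, Pi.smul_apply, Pi.smul_apply, smul_eq_mul,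
    smul_eq_mul]
  push_cast
  rw [mul_div_cancel_left₀ _ (two_ne_zero' ℂ), sub_mul, sub_mul, sub_right_inj]

/-- An intertwiner is determined by its value on a state spanning its sector. -/
lemma exists_mem_adjoin_of_span {L a b : ℕ} (hL : 2 * L = 2 * n + 2)
    {T : Module.End ℂ (V (2 * L))}
    (hT : ∀ X, SymOp (chainC (2 * L) n) (chainD (2 * L) n) X → ∀ u, T (X u) = X (T u))
    (hpar : b % 2 = 0)
    {Ω : V (2 * L)} (hΩ : ∀ u, numOp (2 * L) u = (a : ℂ) • u → ∃ t : ℂ, u = t • Ω)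
    (hnum : numOp (2 * L) (T Ω) = (b : ℂ) • T Ω)
    (hkill : (∀ p, chainC (2 * L) n p Ω = 0) ∨ ∀ p, chainD (2 * L) n p Ω = 0)
    (hb : b = 0 ∨ b = 2 * L → ∃ A ∈ Algebra.adjoin ℂ (centGens L), T Ω = A.mulVec Ω) :
    ∃ A ∈ Algebra.adjoin ℂ (centGens L), ∀ u, numOp (2 * L) u = (a : ℂ) • u → T u = A.mulVec u := by
  have key : ∃ A ∈ Algebra.adjoin ℂ (centGens L), T Ω = A.mulVec Ω := by
    by_cases h : b = 0 ∨ b = 2 * L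
    · exact hb h
    push Not at h
    refine ⟨0, zero_mem _, ?_⟩
    rw [Matrix.zero_mulVec]
    refine (chain_fockRep hL).eq_zero_of_symOp (fun X hX => ?_) hnum hpar h.1 ?_
    · rw [← hT X hX, hX.apply_eq_zero (chain_car hL) hkill, map_zero]
    · rw [Fintype.card_fin, ← hL]
      exact h.2
  obtain ⟨A, hA, hAΩ⟩ := key
  refine ⟨A, hA, fun u hu => ?_⟩
  obtain ⟨t, rfl⟩ := hΩ u hu
  rw [map_smul, Matrix.mulVec_smul, hAΩ]

lemma exists_mem_adjoin_of_symOp {L a b : ℕ} (hL : 2 * L = 2 * n + 2)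
    {T : Module.End ℂ (V (2 * L))}
    (hT : ∀ X, SymOp (chainC (2 * L) n) (chainD (2 * L) n) X → ∀ u, T (X u) = X (T u))
    (ha : a ≤ 2 * L) (hpar : a % 2 = b % 2)
    (hnum : ∀ u, numOp (2 * L) u = (a : ℂ) • u → numOp (2 * L) (T u) = (b : ℂ) • T u) :
    ∃ A ∈ Algebra.adjoin ℂ (centGens L), ∀ u, numOp (2 * L) u = (a : ℂ) • u → T u = A.mulVec u := by
  have hscalar : ∀ {u Ω : V (2 * L)} {t : ℂ} {B : Op (2 * L)},
      B ∈ Algebra.adjoin ℂ (centGens L) → u = t • B.mulVec Ω →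
      ∃ A ∈ Algebra.adjoin ℂ (centGens L), u = A.mulVec Ω := fun {u Ω t B} hB hu =>
    ⟨t • B, Subalgebra.smul_mem _ hB t, by rw [Matrix.smul_mulVec, hu]⟩
  obtain rfl | ha0 := a.eq_zero_or_pos
  · refine exists_mem_adjoin_of_span hL hT (by omega)
      (fun u hu => ⟨_, eq_smul_vacuum_of_numOp hu⟩) (hnum _ numOp_vacuum)
      (Or.inr (chain_fockRep hL).d_vac) ?_
    have hu := hnum _ numOp_vacuum
    rintro (rfl | rfl)
    · have h := eq_smul_vacuum_of_numOp hu
      nth_rewrite 3 [← Matrix.one_mulVec (vacuum _)] at h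
      exact hscalar (one_mem _) h
    · obtain ⟨t, ht⟩ := exists_smul_Fg_vacuum hu
      exact hscalar (Algebra.subset_adjoin (by simp [centGens])) ht
  obtain rfl | haN := ha.eq_or_lt
  · refine exists_mem_adjoin_of_span hL hT (by omega)
      (fun u hu => ⟨_, eq_smul_fullState_of_numOp hu⟩) (hnum _ numOp_fullState)
      (Or.inl fun p => ?_) ?_
    · rw [chainC]
      split_ifs <;> simp [aOp, bOp, fN_fullState]
    have hu := hnum _ numOp_fullState
    rintro (rfl | rfl)
    · obtain ⟨t, ht⟩ := exists_smul_Fdg_fullState hu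
      exact hscalar (Algebra.subset_adjoin (by simp [centGens])) ht
    · have h := eq_smul_fullState_of_numOp hu
      nth_rewrite 3 [← Matrix.one_mulVec (fullState _)] at h
      exact hscalar (one_mem _) h
  obtain ⟨A, hA, hTA⟩ := (chain_fockRep hL).exists_centOps hT ha0
    (by rw [Fintype.card_fin]; omega) hpar hnum
  refine ⟨_, centOps_le_adjoin L hL hA, fun u hu => ?_⟩
  rw [hTA u hu, ← Matrix.toLinAlgEquiv'_apply, AlgEquiv.apply_symm_apply]

end Intertwiners

/-- **Lemma B.3: all periodic Temperley–Lieb intertwiners between sectors whose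
`S^z`-values differ by an even integer come from `U_q^odd sl(2)` together with
the top fermion products:** every `T : H_(k) → H_(k−2t)` commuting with all
periodic `e_j` on `H_(k)` is the restriction to `H_(k)` of an element of the
unital subalgebra generated by
`{F_(2n+1), F†_(2n+1) : 0 ≤ n ≤ L−1} ∪ {F_(N), F†_(N)} ∪ {S^z}`. -/
theorem gl11_periodic_TL_even_intertwiners (L : ℕ) (hL : 0 < L) (k t : ℤ)
    (hk0 : 0 ≤ k) (hkN : k ≤ 2 * L)
    (hk0' : 0 ≤ k - 2 * t) (hkN' : k - 2 * t ≤ 2 * L) :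
    ∀ T ∈ EperEvenSet L k t,
      ∃ Aop ∈ Algebra.adjoin ℂ (centGens L), ∀ v : ↥(sector L k),
        ((T v : V (2 * L))) = Aop.mulVec (v : V (2 * L)) := by
  intro T hT
  obtain ⟨a, rfl⟩ := Int.eq_ofNat_of_zero_le hk0
  obtain ⟨b, hb⟩ := Int.eq_ofNat_of_zero_le hk0'
  have hN : 2 * L = 2 * (L - 1) + 2 := by omega
  have hmem : ∀ v, diagOp (2 * L) (fun m => if m = a then 1 else 0) v ∈ sector L a := fun v =>
    mem_sector_iff.2 (numOp_eq_smul_iff.2 fun x hx => by simp [diagOp_apply, hx])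
  set π : V (2 * L) →ₗ[ℂ] sector L a := LinearMap.codRestrict _ _ hmem with hπ
  have hπ_of_mem : ∀ v (hv : v ∈ sector L a), π v = ⟨v, hv⟩ := by
    refine fun v hv => Subtype.ext (funext fun x => ?_)
    have := numOp_eq_smul_iff.1 (mem_sector_iff.1 hv) x
    by_cases hx : downs x = a
    · simp [hπ, diagOp_apply, hx]
    · simp [hπ, diagOp_apply, hx, this hx]
  set T' : Module.End ℂ (V (2 * L)) := (sector L (a - 2 * t)).subtype ∘ₗ T ∘ₗ π with hT'
  have hcomm : ∀ X, SymOp (chainC (2 * L) (L - 1)) (chainD (2 * L) (L - 1)) X →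
      ∀ u, T' (X u) = X (T' u) := by
    intro X hX u
    have := hX.mem_of_e_mem hN (S := Subalgebra.centralizer ℂ {T'}) fun j => by
      rw [Subalgebra.mem_centralizer_iff]
      rintro _ rfl
      refine LinearMap.ext fun v => ?_
      exact hT j (π v) (π _) (toLin_e_diagOp _ j v).symm
    exact LinearMap.congr_fun ((Subalgebra.mem_centralizer_iff ℂ).1 this T' rfl) u
  obtain ⟨A, hA, hTA⟩ := exists_mem_adjoin_of_symOp (a := a) (b := b) hN hcomm (by omega)
    (by omega) fun u _ => mem_sector_iff.1 (by rw [← hb]; exact (T (π u)).2)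
  refine ⟨A, hA, fun v => ?_⟩
  rw [← hTA v (mem_sector_iff.1 v.2), hT', LinearMap.comp_apply, LinearMap.comp_apply,
    hπ_of_mem v v.2]
  rfl

end SpinChain

end
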